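/- arXiv:math/0602076 — 8 statements merged into one kernel-verified Lean document; each statement's English description precedes it below -/
import Mathlib

section
/- Let Γ be a finitely generated metabelian group which is not virtually nilpotent but all of whose proper quotients are virtually nilpotent (i.e., Γ/N is virtually nilpotent for every nontrivial normal subgroup N of Γ). Then there exists a field K and an injective group homomorphism from Γ into the affine group 𝔸(K) of the K-line. -/
open Pointwise

/-- Two elements of a monoid are *positively independent* if the monoid homomorphism from the
free monoid on two generators sending the generators to them is injective. -/
def PosIndep {G : Type*} [Monoid G] (x y : G) : Prop :=
  Function.Injective
    ((FreeMonoid.lift (fun b : Bool => if b then x else y)) : FreeMonoid Bool →* G)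

/-- A group is virtually nilpotent if it has a nilpotent subgroup of finite index. -/
def VirtuallyNilpotent (G : Type*) [Group G] : Prop :=
  ∃ H : Subgroup G, H.FiniteIndex ∧ Group.IsNilpotent H

/-- A group is metabelian if its commutator subgroup is abelian. -/
def Metabelian (G : Type*) [Group G] : Prop :=
  ∀ a b : commutator G, a * b = b * a

/-- A group is polycyclic iff it is solvable and all its subgroups are finitely generated. -/
def Polycyclic (G : Type*) [Group G] : Prop :=
  IsSolvable G ∧ ∀ H : Subgroup G, Group.FG H

/-- The affine group of the `K`-line: pairs `(a, b)` with `a ∈ Kˣ`, `b ∈ K`,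
acting as `z ↦ a * z + b`. -/
@[ext]
structure Aff (K : Type*) [Field K] where
  a : Kˣ
  b : K

namespace Aff

variable {K : Type*} [Field K]

instance : One (Aff K) := ⟨⟨1, 0⟩⟩
instance : Mul (Aff K) := ⟨fun f g => ⟨f.a * g.a, (f.a : K) * g.b + f.b⟩⟩
instance : Inv (Aff K) := ⟨fun f => ⟨f.a⁻¹, -((↑f.a⁻¹ : K) * f.b)⟩⟩

@[simp] theorem one_a : (1 : Aff K).a = 1 := rfl
@[simp] theorem one_b : (1 : Aff K).b = 0 := rfl
@[simp] theorem mul_a (f g : Aff K) : (f * g).a = f.a * g.a := rfl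
@[simp] theorem mul_b (f g : Aff K) : (f * g).b = (f.a : K) * g.b + f.b := rfl
@[simp] theorem inv_a (f : Aff K) : f⁻¹.a = f.a⁻¹ := rfl
@[simp] theorem inv_b (f : Aff K) : f⁻¹.b = -((↑f.a⁻¹ : K) * f.b) := rfl

instance : Group (Aff K) where
  mul_assoc f g h := by
    ext
    · simp [mul_assoc]
    · simp only [mul_a, mul_b, Units.val_mul]; ring
  one_mul f := by ext <;> simp
  mul_one f := by ext <;> simp
  inv_mul_cancel f := by
    ext
    · simp
    · simp

/-- The canonical projection of the affine group onto `Kˣ`, sending `z ↦ a z + b` to `a`. -/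
def proj : Aff K →* Kˣ where
  toFun f := f.a
  map_one' := rfl
  map_mul' _ _ := rfl

end Aff

/-- The Fitting subgroup: the join of all nilpotent normal subgroups. -/
def FittingSubgroup (G : Type*) [Group G] : Subgroup G :=
  ⨆ (N : Subgroup G) (_ : N.Normal ∧ Group.IsNilpotent N), N

section

open scoped commutatorElement

/-- A group with a homomorphism to `Aff K` whose linear parts take infinitely many values and
which hits a nontrivial translation is not virtually nilpotent. -/
theorem Aff.not_virtuallyNilpotent {G K : Type*} [Group G] [Field K] (ρ : G →* Aff K)
    (hinf : Infinite (Aff.proj.comp ρ).range) {t : G} (hta : (ρ t).a = 1) (htb : (ρ t).b ≠ 0) :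
    ¬ VirtuallyNilpotent G := by
  rintro ⟨H, hH, hnil⟩
  obtain ⟨h, hhH, hh⟩ : ∃ h ∈ H, (ρ h).a ≠ 1 := by
    by_contra! hcon
    have hle : H ≤ (Aff.proj.comp ρ).ker := fun h hh => hcon h hh
    have : (Aff.proj.comp ρ).ker.FiniteIndex := Subgroup.finiteIndex_of_le hle
    have : Finite (Aff.proj.comp ρ).range :=
      Finite.of_equiv _ (QuotientGroup.quotientKerEquivRange (Aff.proj.comp ρ)).toEquiv
    exact not_finite (Aff.proj.comp ρ).range
  obtain ⟨s, hsH, hsa, hsb⟩ : ∃ s ∈ H, (ρ s).a = 1 ∧ (ρ s).b ≠ 0 := by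
    have : Finite (G ⧸ H) := Subgroup.finite_quotient_of_finiteIndex
    choose g hg using fun c : (Aff.proj.comp ρ).range => c.2
    obtain ⟨c, c', hne, heq⟩ := Finite.exists_ne_map_eq_of_infinite
      fun c => ((g c * t * (g c)⁻¹ : G) : G ⧸ H)
    have hgc : ∀ c, (ρ (g c)).a = c := hg
    refine ⟨_, QuotientGroup.eq.1 heq, ?_, ?_⟩
    · simp [hta]
    · have hne' : ((c' : Kˣ) : K) - (c : Kˣ) ≠ 0 := by
        rw [sub_ne_zero]
        exact fun h => hne (Subtype.ext (Units.ext h.symm))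
      have : (ρ ((g c * t * (g c)⁻¹)⁻¹ * (g c' * t * (g c')⁻¹))).b
          = (((c' : Kˣ) : K) - (c : Kˣ)) * (ρ t).b := by
        have h0 := (c : Kˣ).mul_inv
        have h0' := (c' : Kˣ).mul_inv
        simp only [map_mul, map_inv, Aff.mul_a, Aff.mul_b, Aff.inv_a, Aff.inv_b, hta, hgc,
          mul_one, mul_inv_cancel, inv_one, Units.val_one]
        linear_combination (ρ (g c)).b * h0 - (ρ (g c')).b * h0'
      rw [this]
      exact mul_ne_zero hne' htb
  obtain ⟨n, hn⟩ := Subgroup.nilpotent_iff_lowerCentralSeries.1 hnil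
  have key : ∀ n, ∃ x ∈ Subgroup.lowerCentralSeries (⊤ : Subgroup H) n,
      (ρ x).a = 1 ∧ (ρ x).b ≠ 0 := by
    intro n
    induction n with
    | zero => exact ⟨⟨s, hsH⟩, trivial, hsa, hsb⟩
    | succ n ih =>
      obtain ⟨x, hx, hxa, hxb⟩ := ih
      refine ⟨⁅x, ⟨h, hhH⟩⁆, Subgroup.commutator_mem_commutator hx (Subgroup.mem_top _), ?_, ?_⟩
      · simp [commutatorElement_def, hxa]
      · have : (ρ (⁅x, ⟨h, hhH⟩⁆ : H)).b = (1 - ((ρ h).a : K)) * (ρ x).b := by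
          simp [commutatorElement_def, hxa]
          ring
        rw [this]
        refine mul_ne_zero (sub_ne_zero.2 fun e => hh (Units.ext e.symm)) hxb
  obtain ⟨x, hx, -, hxb⟩ := key n
  rw [hn, Subgroup.mem_bot] at hx
  exact hxb (by simp [hx])

/-- The subgroup of `Γ` corresponding to a submodule along a homomorphism. -/
def Submodule.mapSubgroup {Γ R A : Type*} [Group Γ] [Ring R] [AddCommGroup A] [Module R A]
    (ι : Multiplicative A →* Γ) (W : Submodule R A) : Subgroup Γ :=
  (AddSubgroup.toSubgroup W.toAddSubgroup).map ι

theorem Submodule.mem_mapSubgroup {Γ R A : Type*} [Group Γ] [Ring R] [AddCommGroup A]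
    [Module R A] {ι : Multiplicative A →* Γ} {W : Submodule R A} {x : Γ} :
    x ∈ W.mapSubgroup ι ↔ ∃ a ∈ W, ι (.ofAdd a) = x :=
  Iff.rfl

variable {Γ R A : Type*} [Group Γ] [CommRing R] [AddCommGroup A] [Module R A]
  {u : Γ →* R} {ι : Multiplicative A →* Γ}

theorem isNilpotent_of_pow_le_annihilator
    (hact : ∀ g a, ι (.ofAdd (u g • a)) = g * ι (.ofAdd a) * g⁻¹)
    (hc : ∀ g h : Γ, ∃ a, ι (.ofAdd a) = ⁅g, h⁆)
    {I : Ideal R} {k : ℕ} (hI : I ^ k ≤ Module.annihilator R A)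
    {H : Subgroup Γ} (hH : ∀ g ∈ H, u g - 1 ∈ I) : Group.IsNilpotent H := by
  rw [Subgroup.nilpotent_iff_finite_descending_central_series]
  refine ⟨k + 1, fun n => n.casesOn ⊤ fun n =>
    ((I ^ n • (⊤ : Submodule R A)).mapSubgroup ι).subgroupOf H, ⟨rfl, ?_⟩, ?_⟩
  · rintro x (_ | n) hx g
    · obtain ⟨a, ha⟩ := hc x g
      simp only [Subgroup.mem_subgroupOf, Submodule.mem_mapSubgroup]
      exact ⟨a, by simp, ha⟩
    · simp only [Subgroup.mem_subgroupOf, Submodule.mem_mapSubgroup] at hx ⊢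
      obtain ⟨a, ha, hax⟩ := hx
      refine ⟨-((u g - 1) • a), neg_mem ?_, ?_⟩
      · rw [pow_succ', Submodule.mul_smul]
        exact Submodule.smul_mem_smul (hH g g.2) ha
      · have h1 : -((u g - 1) • a) = a + u g • (-a) := by
          rw [sub_smul, one_smul, smul_neg]; abel
        rw [h1, ofAdd_add, map_mul, hact, ofAdd_neg, map_inv, hax]
        simp [commutatorElement_def, mul_assoc]
  · have h0 : I ^ k • (⊤ : Submodule R A) = ⊥ := by
      rw [eq_bot_iff, Submodule.smul_le]
      intro r hr a _
      exact Module.mem_annihilator.1 (hI hr) a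
    rw [eq_bot_iff]
    intro x hx
    simp only [h0, Subgroup.mem_subgroupOf, Submodule.mem_mapSubgroup, Submodule.mem_bot,
      exists_eq_left, ofAdd_zero, map_one] at hx
    exact Subgroup.mem_bot.2 (Subtype.ext hx.symm)

/-- The character of `Γ` on the residue field at `p`. -/
noncomputable def residueChar (u : Γ →* R) (p : PrimeSpectrum R) :
    Γ →* p.asIdeal.ResidueFieldˣ :=
  (Units.map (algebraMap R p.asIdeal.ResidueField : R →* _)).comp u.toHomUnits

@[simp] theorem coe_residueChar (p : PrimeSpectrum R) (g : Γ) :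
    (residueChar u p g : p.asIdeal.ResidueField) = algebraMap R _ (u g) := rfl

theorem exists_infinite_residueChar [IsNoetherianRing R] [Module.Finite R A]
    (hact : ∀ g a, ι (.ofAdd (u g • a)) = g * ι (.ofAdd a) * g⁻¹)
    (hc : ∀ g h : Γ, ∃ a, ι (.ofAdd a) = ⁅g, h⁆) (hnvn : ¬ VirtuallyNilpotent Γ) :
    ∃ p ∈ Module.support R A, Infinite (residueChar u p).range := by
  by_contra! hcon
  set I := Module.annihilator R A
  obtain ⟨k, hk⟩ := I.exists_radical_pow_le_of_fg (IsNoetherian.noetherian _)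
  have hfin := I.finite_minimalPrimes_of_isNoetherianRing
  have : Finite I.minimalPrimes := hfin
  let χ : (p : I.minimalPrimes) → Subgroup Γ := fun p =>
    (residueChar u ⟨p.1, p.2.1.1⟩).ker
  refine hnvn ⟨⨅ p, χ p, Subgroup.finiteIndex_iInf fun p => ?_,
    isNilpotent_of_pow_le_annihilator hact hc hk ?_⟩
  · have : Finite (residueChar u ⟨p.1, p.2.1.1⟩).range := by
      refine hcon _ ?_
      rw [Module.support_eq_zeroLocus]
      exact p.2.1.2
    exact Subgroup.finiteIndex_ker _
  · intro g hg
    rw [← Ideal.sInf_minimalPrimes, Submodule.mem_sInf]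
    intro p hp
    have hgp := Subgroup.mem_iInf.1 hg ⟨p, hp⟩
    have : Ideal.IsPrime p := hp.1.1
    rw [← Ideal.algebraMap_residueField_eq_zero, map_sub, map_one, sub_eq_zero]
    exact congrArg Units.val (MonoidHom.mem_ker.1 hgp)

theorem exists_residueField_functional [Module.Finite R A] {p : PrimeSpectrum R}
    (hp : p ∈ Module.support R A) :
    ∃ φ : A →ₗ[R] p.asIdeal.ResidueField, φ ≠ 0 := by
  have : Nontrivial (TensorProduct R p.asIdeal.ResidueField A) :=
    (Module.mem_support_iff_nontrivial_residueField_tensorProduct p).1 hp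
  obtain ⟨v, hv⟩ := exists_ne (0 : TensorProduct R p.asIdeal.ResidueField A)
  obtain ⟨f, hf⟩ : ∃ f : Module.Dual p.asIdeal.ResidueField
      (TensorProduct R p.asIdeal.ResidueField A), f v ≠ 0 := by
    by_contra! h
    exact hv ((Module.forall_dual_apply_eq_zero_iff _ v).1 h)
  refine ⟨f.restrictScalars R ∘ₗ TensorProduct.mk R _ A 1, fun h0 => hf ?_⟩
  suffices f = 0 by simp [this]
  refine TensorProduct.AlgebraTensorModule.curry_injective (LinearMap.ext_ring ?_)
  ext a
  exact LinearMap.congr_fun h0 a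

theorem moduleFinite_of_fg [Group.FG Γ] (hι : Function.Injective ι)
    (hact : ∀ g a, ι (.ofAdd (u g • a)) = g * ι (.ofAdd a) * g⁻¹)
    (hr : ι.range = commutator Γ) : Module.Finite R A := by
  have hc : ∀ g h, ∃ a, ι (.ofAdd a) = ⁅g, h⁆ := fun g h => by
    have : ⁅g, h⁆ ∈ commutator Γ :=
      Subgroup.commutator_mem_commutator (Subgroup.mem_top g) (Subgroup.mem_top h)
    rwa [← hr] at this
  choose c hc using hc
  obtain ⟨S, hS, hfin⟩ := Group.fg_iff.1 ‹Group.FG Γ›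
  have inj : ∀ {a b : A}, ι (.ofAdd a) = ι (.ofAdd b) → a = b := fun h => hι h
  have c_swap : ∀ g h, c h g = -c g h := fun g h => inj (by
    rw [ofAdd_neg, map_inv, hc, hc, commutatorElement_inv])
  have c_mul : ∀ g h k, c (g * h) k = u g • c h k + c g k := fun g h k => inj (by
    rw [ofAdd_add, map_mul, hact, hc, hc, hc]
    simp [commutatorElement_def, mul_assoc])
  have c_one : ∀ k, c 1 k = 0 := fun k => inj (by rw [hc]; simp)
  have c_inv : ∀ g k, c g⁻¹ k = -(u g⁻¹ • c g k) := fun g k => by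
    have := c_mul g⁻¹ g k
    rw [inv_mul_cancel, c_one] at this
    exact (neg_eq_of_add_eq_zero_right this.symm).symm
  set W := Submodule.span R (Set.image2 c S S)
  have step : ∀ k, (∀ s ∈ S, c s k ∈ W) → ∀ g, c g k ∈ W := by
    intro k hk g
    have hg : g ∈ Subgroup.closure S := hS ▸ Subgroup.mem_top g
    induction hg using Subgroup.closure_induction with
    | mem s hs => exact hk s hs
    | one => rw [c_one]; exact zero_mem _
    | mul x y _ _ hx hy => rw [c_mul]; exact add_mem (W.smul_mem _ hy) hx
    | inv x _ hx => rw [c_inv]; exact neg_mem (W.smul_mem _ hx)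
  have hall : ∀ g k, c g k ∈ W := fun g k =>
    step k (fun s hs => by
      rw [c_swap]
      exact neg_mem (step s (fun t ht => Submodule.subset_span ⟨t, ht, s, hs, rfl⟩) k)) g
  have hle : commutator Γ ≤ W.mapSubgroup ι := by
    rw [commutator_def, Subgroup.commutator_le]
    exact fun g _ h _ => ⟨c g h, hall g h, hc g h⟩
  refine ⟨⟨(hfin.image2 c hfin).toFinset, ?_⟩⟩
  rw [Set.Finite.coe_toFinset, eq_top_iff]
  intro a _
  obtain ⟨b, hb, hba⟩ := hle (hr ▸ ⟨.ofAdd a, rfl⟩ : ι (.ofAdd a) ∈ commutator Γ)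
  exact inj hba ▸ hb

/-- An equivariant additive map `φ` and an element `z` yield the affine representation with
translation part `g ↦ φ ⁅g, z⁆`. -/
theorem exists_affine_of_functional {K : Type*} [Field K] [Algebra R K]
    (hι : Function.Injective ι)
    (hact : ∀ g a, ι (.ofAdd (u g • a)) = g * ι (.ofAdd a) * g⁻¹)
    (hc : ∀ g h : Γ, ∃ a, ι (.ofAdd a) = ⁅g, h⁆) (φ : A →ₗ[R] K) (z : Γ) :
    ∃ ρ : Γ →* Aff K, (∀ g, ((ρ g).a : K) = algebraMap R K (u g)) ∧
      ∀ a, (ρ (ι (.ofAdd a))).b = (1 - algebraMap R K (u z)) * φ a := by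
  choose c hc using fun g => hc g z
  have inj : ∀ {a b : A}, ι (.ofAdd a) = ι (.ofAdd b) → a = b := fun h => hι h
  refine ⟨MonoidHom.mk' (fun g =>
    ⟨Units.map (algebraMap R K : R →* K) (u.toHomUnits g), φ (c g)⟩) fun g h => ?_,
    fun g => rfl, fun a => ?_⟩
  · have : c (g * h) = u g • c h + c g := inj (by
      rw [ofAdd_add, map_mul, hact, hc, hc, hc]
      simp [commutatorElement_def, mul_assoc])
    ext
    · simp
    · simp [this, Algebra.smul_def]
  · have : c (ι (.ofAdd a)) = a - u z • a := inj (by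
      rw [hc, sub_eq_add_neg, ← smul_neg, ofAdd_add, map_mul, hact, ofAdd_neg, map_inv]
      simp [commutatorElement_def, mul_assoc])
    simp [this, Algebra.smul_def, sub_mul]

theorem exists_affine_not_virtuallyNilpotent [Group.FG Γ] [IsNoetherianRing R]
    (hι : Function.Injective ι)
    (hact : ∀ g a, ι (.ofAdd (u g • a)) = g * ι (.ofAdd a) * g⁻¹)
    (hr : ι.range = commutator Γ) (hnvn : ¬ VirtuallyNilpotent Γ) :
    ∃ (p : PrimeSpectrum R) (ρ : Γ →* Aff p.asIdeal.ResidueField),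
      Infinite (Aff.proj.comp ρ).range ∧ ∃ t, (ρ t).a = 1 ∧ (ρ t).b ≠ 0 := by
  have hc : ∀ g h, ∃ a, ι (.ofAdd a) = ⁅g, h⁆ := fun g h => by
    have : ⁅g, h⁆ ∈ commutator Γ :=
      Subgroup.commutator_mem_commutator (Subgroup.mem_top g) (Subgroup.mem_top h)
    rwa [← hr] at this
  have := moduleFinite_of_fg hι hact hr
  obtain ⟨p, hp, hinf⟩ := exists_infinite_residueChar hact hc hnvn
  obtain ⟨φ, hφ⟩ := exists_residueField_functional hp
  obtain ⟨a, ha⟩ : ∃ a, φ a ≠ 0 := by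
    by_contra! h
    exact hφ (LinearMap.ext h)
  obtain ⟨z, hz⟩ : ∃ z, residueChar u p z ≠ 1 := by
    by_contra! h
    have : residueChar u p = 1 := MonoidHom.ext h
    rw [this, MonoidHom.range_one] at hinf
    exact not_finite (⊥ : Subgroup p.asIdeal.ResidueFieldˣ)
  obtain ⟨ρ, hρa, hρb⟩ := exists_affine_of_functional hι hact hc φ z
  have hproj : Aff.proj.comp ρ = residueChar u p := by
    ext g
    exact hρa g
  refine ⟨p, ρ, hproj ▸ hinf, ι (.ofAdd a), ?_, ?_⟩
  · change (Aff.proj.comp ρ) _ = 1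
    have : ι (.ofAdd a) ∈ commutator Γ := hr ▸ ⟨_, rfl⟩
    exact Abelianization.commutator_subset_ker _ this
  · rw [hρb]
    refine mul_ne_zero (sub_ne_zero.2 fun h => hz (Units.ext ?_)) ha
    simpa using h.symm

theorem countable_of_finiteType_int (R : Type*) [CommRing R] [Algebra ℤ R]
    [Algebra.FiniteType ℤ R] :
    Countable R := by
  obtain ⟨n, f, hf⟩ := Algebra.FiniteType.iff_quotient_mvPolynomial''.1
    (inferInstance : Algebra.FiniteType ℤ R)
  have : Countable (MvPolynomial (Fin n) ℤ) := by
    rw [← Cardinal.mk_le_aleph0_iff]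
    exact MvPolynomial.cardinalMk_le_max.trans (by simp)
  exact hf.countable

theorem countable_residueField {R : Type*} [CommRing R] [Countable R] (p : Ideal R)
    [p.IsPrime] : Countable p.ResidueField := by
  have : Countable (R ⧸ p) := Ideal.Quotient.mk_surjective.countable
  have hsurj : Function.Surjective fun x : (R ⧸ p) × (R ⧸ p) =>
      algebraMap _ p.ResidueField x.1 / algebraMap _ p.ResidueField x.2 := fun z => by
    obtain ⟨x, y, -, h⟩ := IsFractionRing.div_surjective (A := R ⧸ p) z
    exact ⟨(x, y), h⟩
  exact hsurj.countable

/-- Functoriality of the affine group in the field. -/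
def Aff.map {K L : Type*} [Field K] [Field L] (f : K →+* L) : Aff K →* Aff L where
  toFun x := ⟨Units.map f x.a, f x.b⟩
  map_one' := by ext <;> simp
  map_mul' x y := by ext <;> simp

theorem Aff.map_injective {K L : Type*} [Field K] [Field L] (f : K →+* L) :
    Function.Injective (Aff.map f) := by
  intro x y h
  rw [Aff.ext_iff] at h ⊢
  exact ⟨Units.map_injective f.injective h.1, f.injective h.2⟩

theorem exists_residueField_affine (Γ : Type*) [Group Γ] [Group.FG Γ] (hmeta : Metabelian Γ)
    (hnvn : ¬ VirtuallyNilpotent Γ) :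
    ∃ (p : PrimeSpectrum (MonoidAlgebra ℤ (Abelianization Γ)))
      (ρ : Γ →* Aff p.asIdeal.ResidueField),
      Infinite (Aff.proj.comp ρ).range ∧ ∃ t, (ρ t).a = 1 ∧ (ρ t).b ≠ 0 := by
  let _ : CommGroup (commutator Γ) :=
    { (inferInstance : Group (commutator Γ)) with mul_comm := hmeta }
  let A := Additive (commutator Γ)
  let conj : Γ →* AddMonoid.End A :=
    { toFun g := MonoidHom.toAdditive (MulAut.conjNormal g : MulAut (commutator Γ)).toMonoidHom
      map_one' := by
        rw [map_one]
        rfl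
      map_mul' g h := by
        rw [map_mul]
        rfl }
  let conjAb : Abelianization Γ →* AddMonoid.End A :=
    QuotientGroup.lift (commutator Γ) conj fun g hg => by
      ext a
      exact congrArg Subtype.val (mul_inv_eq_of_eq_mul (hmeta ⟨g, hg⟩ a))
  let α : MonoidAlgebra ℤ (Abelianization Γ) →+* AddMonoid.End A :=
    (MonoidAlgebra.lift ℤ (AddMonoid.End A) (Abelianization Γ) conjAb).toRingHom
  let _ : Module (MonoidAlgebra ℤ (Abelianization Γ)) A := Module.compHom A α
  have : Group.FG (Abelianization Γ) := QuotientGroup.fg _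
  have : IsNoetherianRing (MonoidAlgebra ℤ (Abelianization Γ)) :=
    Algebra.FiniteType.isNoetherianRing ℤ _
  refine exists_affine_not_virtuallyNilpotent
    (u := (MonoidAlgebra.of ℤ (Abelianization Γ)).comp Abelianization.of)
    (A := A) (ι := (commutator Γ).subtype.comp
      (MulEquiv.refl (commutator Γ) : Multiplicative A ≃* commutator Γ).toMonoidHom) ?_ ?_ ?_ hnvn
  · exact Subtype.val_injective
  · intro g a
    have : (MonoidAlgebra.of ℤ (Abelianization Γ) (Abelianization.of g)) • a = conj g a := by
      change α _ a = _
      simp only [α, AlgHom.toRingHom_eq_coe, RingHom.coe_coe, MonoidAlgebra.lift_of]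
      rfl
    change ((commutator Γ).subtype
      ((MonoidAlgebra.of ℤ (Abelianization Γ) (Abelianization.of g)) • a : A).toMul : Γ) = _
    rw [this]
    rfl
  · ext x
    exact ⟨fun ⟨a, ha⟩ => ha ▸ a.2, fun hx => ⟨⟨x, hx⟩, rfl⟩⟩

end

/-- A finitely generated metabelian group which is not virtually nilpotent but all
of whose proper quotients are virtually nilpotent embeds into the affine group of a `K`-line. -/
theorem stmt_3 (Γ : Type*) [Group Γ] [Group.FG Γ] (hmeta : Metabelian Γ)
    (hnvn : ¬ VirtuallyNilpotent Γ)
    (hjnvn : ∀ (N : Subgroup Γ) [N.Normal], N ≠ ⊥ → VirtuallyNilpotent (Γ ⧸ N)) :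
    ∃ (K : Type) (inst : Field K),
      letI := inst
      ∃ ρ : Γ →* Aff K, Function.Injective ρ := by
  obtain ⟨p, ρ, hinf, t, hta, htb⟩ := exists_residueField_affine Γ hmeta hnvn
  have hinj : Function.Injective ρ := by
    rw [← MonoidHom.ker_eq_bot_iff]
    by_contra hker
    refine Aff.not_virtuallyNilpotent (QuotientGroup.kerLift ρ) ?_ (t := (t : Γ ⧸ ρ.ker)) hta htb
      (hjnvn _ hker)
    have : (Aff.proj.comp (QuotientGroup.kerLift ρ)).range = (Aff.proj.comp ρ).range := by
      rw [MonoidHom.range_comp, MonoidHom.range_comp]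
      congr 1
      ext x
      exact ⟨fun ⟨y, hy⟩ => by
        obtain ⟨y, rfl⟩ := QuotientGroup.mk_surjective y
        exact ⟨y, hy⟩, fun ⟨y, hy⟩ => ⟨y, hy⟩⟩
    rwa [this]
  have : Group.FG (Abelianization Γ) := QuotientGroup.fg _
  have : Countable (MonoidAlgebra ℤ (Abelianization Γ)) := countable_of_finiteType_int _
  have : Countable p.asIdeal.ResidueField := countable_residueField _
  let e : p.asIdeal.ResidueField ≃+* Shrink.{0} p.asIdeal.ResidueField :=
    (Shrink.ringEquiv _).symm
  exact ⟨Shrink.{0} p.asIdeal.ResidueField, inferInstance,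
    (Aff.map e.toRingHom).comp ρ, (Aff.map_injective _).comp hinj⟩
end

section
/- For every integer n ≥ 1 there exists a complex number x with x^{3·n!} + x^{n!} + 1 = 0 such that, letting A and B be the elements of the affine group ℂ ⋊ ℂˣ corresponding to the maps z ↦ xz and z ↦ xz + 1 respectively, the subgroup Γ generated by A and B satisfies: Γ is polycyclic (solvable with every subgroup finitely generated), Γ is not virtually nilpotent, and no two elements of Γ that are each a product of at most n−1 elements of the set Σ = {1, A, A⁻¹, B, B⁻¹} are positively independent. -/
open Pointwise

theorem not_posIndep_of_mul_eq_mul {G : Type*} [Monoid G] {g h c d : G}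
    (hc : c ∈ Submonoid.closure {g, h}) (hd : d ∈ Submonoid.closure {g, h})
    (hcd : g * c = h * d) : ¬ PosIndep g h := by
  intro hinj
  have key : ∀ e ∈ Submonoid.closure {g, h}, ∃ w : FreeMonoid Bool,
      FreeMonoid.lift (fun b : Bool => if b then g else h) w = e := by
    intro e he
    have hle : Submonoid.closure {g, h} ≤
        MonoidHom.mrange (FreeMonoid.lift (fun b : Bool => if b then g else h)) := by
      rw [Submonoid.closure_le]
      rintro y (rfl | rfl)
      · exact ⟨FreeMonoid.of true, by simp⟩
      · exact ⟨FreeMonoid.of false, by simp⟩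
    exact hle he
  obtain ⟨v, hv⟩ := key c hc
  obtain ⟨w, hw⟩ := key d hd
  have h1 : FreeMonoid.of true * v = FreeMonoid.of false * w := by
    apply hinj
    simp only [map_mul, FreeMonoid.lift_eval_of, hv, hw]
    simpa using hcd
  have h2 := congrArg FreeMonoid.toList h1
  simp at h2

namespace Aff

variable {K : Type*} [Field K]

theorem pow_a (g : Aff K) (k : ℕ) : (g ^ k).a = g.a ^ k := map_pow proj g k

theorem zpow_a (g : Aff K) (k : ℤ) : (g ^ k).a = g.a ^ k := map_zpow proj g k

theorem mul_comm_of_translation {g h : Aff K} (hg : g.a = 1) (hh : h.a = 1) :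
    g * h = h * g := by
  ext
  · simp [mul_comm]
  · simp [hg, hh, add_comm]

/-- Two affine maps with the same linear part `u`, a root of `X ^ (p + q) + X ^ p + 1`,
satisfy an explicit positive relation. -/
theorem word_eq_pow {g h : Aff K} {p q : ℕ} (ha : g.a = h.a)
    (hu : (h.a : K) ^ (p + 1 + (q + 1)) + (h.a : K) ^ (p + 1) + 1 = 0) :
    g * (h ^ p * (g * (h ^ q * g))) = h * h ^ (p + q + 2) := by
  obtain ⟨s, rfl⟩ : ∃ s, g = s * h := ⟨g * h⁻¹, by simp⟩
  have hs : s.a = 1 := by simpa using ha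
  have key : s * (h ^ (p + 1) * (s * (h ^ (q + 1) * s))) = h ^ (p + 1) * h ^ (q + 1) := by
    ext
    · simp [hs]
    · simp only [mul_b, hs, pow_a, Units.val_one, Units.val_pow_eq_pow_val]
      linear_combination s.b * hu
  calc s * h * (h ^ p * (s * h * (h ^ q * (s * h))))
      = s * (h ^ (p + 1) * (s * (h ^ (q + 1) * s))) * h := by
        simp only [pow_succ', mul_assoc]
    _ = h * h ^ (p + q + 2) := by
        rw [key, ← pow_add, ← pow_succ, ← pow_succ']
        congr 1
        omega

theorem exists_mul_eq_mul {g h : Aff K} {p q : ℕ} (ha : g.a = h.a) (hp : 0 < p) (hq : 0 < q)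
    (hu : (h.a : K) ^ (p + q) + (h.a : K) ^ p + 1 = 0) :
    ∃ c ∈ Submonoid.closure {g, h}, ∃ d ∈ Submonoid.closure {g, h}, g * c = h * d := by
  obtain ⟨p, rfl⟩ := Nat.exists_eq_succ_of_ne_zero hp.ne'
  obtain ⟨q, rfl⟩ := Nat.exists_eq_succ_of_ne_zero hq.ne'
  have hg : g ∈ Submonoid.closure {g, h} := Submonoid.subset_closure (by simp)
  have hh : h ∈ Submonoid.closure {g, h} := Submonoid.subset_closure (by simp)
  exact ⟨_, mul_mem (pow_mem hh p) (mul_mem hg (mul_mem (pow_mem hh q) hg)), _,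
    pow_mem hh (p + q + 2), word_eq_pow ha hu⟩

end Aff

theorem exists_trinomial_zpow {K : Type*} [Field K] {x : Kˣ} {N : ℕ} (hN : 0 < N)
    (hx : (x : K) ^ (3 * N) + (x : K) ^ N + 1 = 0) {k : ℤ} (hk : k ∣ N) :
    ∃ p q : ℕ, 0 < p ∧ 0 < q ∧
      ((x ^ k : Kˣ) : K) ^ (p + q) + ((x ^ k : Kˣ) : K) ^ p + 1 = 0 := by
  have hx0 : (x : K) ≠ 0 := x.ne_zero
  have hpos : ∀ a m : ℕ, N = a * m → 0 < m ∧ (x : K) ^ N = ((x : K) ^ a) ^ m := by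
    rintro a m rfl
    exact ⟨Nat.pos_of_mul_pos_left hN, pow_mul _ _ _⟩
  rw [mul_comm, pow_mul] at hx
  obtain ⟨a, rfl | rfl⟩ := Int.eq_nat_or_neg k
  · obtain ⟨m, hm⟩ := Int.natCast_dvd_natCast.1 hk
    obtain ⟨hm0, hxm⟩ := hpos a m hm
    refine ⟨m, 2 * m, hm0, by omega, ?_⟩
    rw [hxm] at hx
    rw [← hx]
    simp only [zpow_natCast, Units.val_pow_eq_pow_val]
    ring
  · obtain ⟨m, hm⟩ := Int.natCast_dvd_natCast.1 ((neg_dvd).1 hk)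
    obtain ⟨hm0, hxm⟩ := hpos a m hm
    refine ⟨2 * m, m, by omega, hm0, ?_⟩
    rw [hxm] at hx
    have hy : (((x : K) ^ a) ^ m) ≠ 0 := pow_ne_zero _ (pow_ne_zero _ hx0)
    simp only [zpow_neg, zpow_natCast, Units.val_inv_eq_inv_val, Units.val_pow_eq_pow_val,
      inv_pow]
    have h1 : ((x : K) ^ a) ^ (2 * m + m) = (((x : K) ^ a) ^ m) ^ 3 := by ring
    have h2 : ((x : K) ^ a) ^ (2 * m) = (((x : K) ^ a) ^ m) ^ 2 := by ring
    rw [h1, h2]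
    field_simp
    linear_combination hx

namespace Aff

variable {K : Type*} [Field K]

/-- If `x` is a root of `X ^ (3 * N) + X ^ N + 1`, no two affine maps whose linear parts are powers
of `x` with exponents dividing `N` (or zero) are positively independent. -/
theorem not_posIndep_of_zpow {x : Kˣ} {N : ℕ} (hN : 0 < N)
    (hx : (x : K) ^ (3 * N) + (x : K) ^ N + 1 = 0) {g h : Aff K} {i j : ℤ}
    (hi : i = 0 ∨ i ∣ N) (hj : j = 0 ∨ j ∣ N) (hg : g.a = x ^ i) (hh : h.a = x ^ j) :
    ¬ PosIndep g h := by
  have hgm : g ∈ Submonoid.closure {g, h} := Submonoid.subset_closure (by simp)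
  have hhm : h ∈ Submonoid.closure {g, h} := Submonoid.subset_closure (by simp)
  -- a relation between positive words starting in `g` and in `h` suffices
  have reduce : ∀ (s t : Aff K), s ∈ Submonoid.closure {g, h} → t ∈ Submonoid.closure {g, h} →
      (∃ c ∈ Submonoid.closure {g * s, h * t}, ∃ d ∈ Submonoid.closure {g * s, h * t},
        g * s * c = h * t * d) → ¬ PosIndep g h := by
    rintro s t hs ht ⟨c, hc, d, hd, hcd⟩
    have hle : Submonoid.closure {g * s, h * t} ≤ Submonoid.closure {g, h} := by
      rw [Submonoid.closure_le]
      rintro y (rfl | rfl)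
      · exact mul_mem hgm hs
      · exact mul_mem hhm ht
    exact not_posIndep_of_mul_eq_mul (mul_mem hs (hle hc)) (mul_mem ht (hle hd))
      (by simpa only [mul_assoc] using hcd)
  have same : ∀ (s t : Aff K) (k : ℤ), s ∈ Submonoid.closure {g, h} →
      t ∈ Submonoid.closure {g, h} → k ∣ N → (g * s).a = x ^ k → (h * t).a = x ^ k →
      ¬ PosIndep g h := by
    intro s t k hs ht hk hga hha
    obtain ⟨p, q, hp, hq, hpq⟩ := exists_trinomial_zpow hN hx hk
    exact reduce s t hs ht
      (exists_mul_eq_mul (hga.trans hha.symm) hp hq (by rw [hha]; exact hpq))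
  have powers : ∀ (a b : ℕ) (k : ℤ), 0 < a → 0 < b → k ∣ N → i * a = k → j * b = k →
      ¬ PosIndep g h := by
    intro a b k ha hb hk hia hjb
    obtain ⟨a, rfl⟩ := Nat.exists_eq_succ_of_ne_zero ha.ne'
    obtain ⟨b, rfl⟩ := Nat.exists_eq_succ_of_ne_zero hb.ne'
    refine same (g ^ a) (h ^ b) k (pow_mem hgm a) (pow_mem hhm b) hk ?_ ?_
    · rw [← pow_succ', pow_a, hg, ← hia, zpow_mul, zpow_natCast]
    · rw [← pow_succ', pow_a, hh, ← hjb, zpow_mul, zpow_natCast]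
  have opposite : ∀ a b : ℕ, 0 < a → 0 < b → i * b + j * a = 0 → ¬ PosIndep g h := by
    intro a b ha hb hab
    obtain ⟨a, rfl⟩ := Nat.exists_eq_succ_of_ne_zero ha.ne'
    obtain ⟨b, rfl⟩ := Nat.exists_eq_succ_of_ne_zero hb.ne'
    have h1 : (g ^ (b + 1) * h ^ (a + 1)).a = 1 := by
      rw [mul_a, pow_a, pow_a, hg, hh, ← zpow_natCast, ← zpow_natCast, ← zpow_mul, ← zpow_mul,
        ← zpow_add, ← zpow_zero x]
      exact congrArg _ hab
    have h2 : (h ^ (a + 1) * g ^ (b + 1)).a = 1 := by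
      rw [← h1, mul_a, mul_a, mul_comm]
    have hcomm := mul_comm_of_translation h1 h2
    refine reduce (g ^ b * h ^ (a + 1)) (h ^ a * g ^ (b + 1))
      (mul_mem (pow_mem hgm _) (pow_mem hhm _)) (mul_mem (pow_mem hhm _) (pow_mem hgm _)) ?_
    simp only [← mul_assoc, ← pow_succ']
    exact ⟨h ^ (a + 1) * g ^ (b + 1), Submonoid.subset_closure (by simp),
      g ^ (b + 1) * h ^ (a + 1), Submonoid.subset_closure (by simp),
      by simpa only [← mul_assoc] using hcomm⟩
  have lcm_dvd : ∀ a b : ℕ, (a : ℤ) ∣ N → (b : ℤ) ∣ N → 0 < a → 0 < b →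
      ∃ c d : ℕ, 0 < c ∧ 0 < d ∧ a * c = b * d ∧ a * c ∣ N := by
    intro a b ha hb ha0 hb0
    obtain ⟨c, hc⟩ := Nat.dvd_lcm_left a b
    obtain ⟨d, hd⟩ := Nat.dvd_lcm_right a b
    have hl := Nat.lcm_pos ha0 hb0
    refine ⟨c, d, ?_, ?_, hc.symm.trans hd, ?_⟩
    · exact Nat.pos_of_mul_pos_left (hc ▸ hl)
    · exact Nat.pos_of_mul_pos_left (hd ▸ hl)
    · rw [← hc]
      exact Nat.lcm_dvd (Int.natCast_dvd_natCast.1 ha) (Int.natCast_dvd_natCast.1 hb)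
  rcases eq_or_ne i 0 with rfl | hi0
  · rcases eq_or_ne j 0 with rfl | hj0
    · exact opposite 1 1 one_pos one_pos (by simp)
    · refine same h 1 j hhm (one_mem _) (hj.resolve_left hj0) ?_ ?_
      · simp [hg, hh]
      · simp [hh]
  rcases eq_or_ne j 0 with rfl | hj0
  · refine same 1 g i (one_mem _) hgm (hi.resolve_left hi0) ?_ ?_
    · simp [hg]
    · simp [hg, hh]
  replace hi := hi.resolve_left hi0
  replace hj := hj.resolve_left hj0
  obtain ⟨a, rfl | rfl⟩ := Int.eq_nat_or_neg i <;> obtain ⟨b, rfl | rfl⟩ := Int.eq_nat_or_neg j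
  · obtain ⟨c, d, hc, hd, hcd, hN'⟩ := lcm_dvd a b hi hj (by omega) (by omega)
    exact powers c d (a * c : ℕ) hc hd (Int.natCast_dvd_natCast.2 hN') (by simp)
      (by rw [hcd]; simp)
  · exact opposite a b (by omega) (by omega) (by ring)
  · exact opposite a b (by omega) (by omega) (by ring)
  · obtain ⟨c, d, hc, hd, hcd, hN'⟩ :=
      lcm_dvd a b (neg_dvd.1 hi) (neg_dvd.1 hj) (by omega) (by omega)
    exact powers c d (-(a * c : ℕ)) hc hd (neg_dvd.2 (Int.natCast_dvd_natCast.2 hN')) (by simp)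
      (by rw [hcd]; simp)

theorem exists_zpow_of_mem_ball {x : Kˣ} {m : ℕ} {g : Aff K}
    (hg : g ∈ ({1, ⟨x, 0⟩, (⟨x, 0⟩ : Aff K)⁻¹, ⟨x, 1⟩, (⟨x, 1⟩ : Aff K)⁻¹} : Set (Aff K)) ^ m) :
    ∃ i : ℤ, i.natAbs ≤ m ∧ g.a = x ^ i := by
  induction m generalizing g with
  | zero =>
    rw [pow_zero, Set.mem_one] at hg
    exact ⟨0, by simp [hg]⟩
  | succ m ih =>
    rw [pow_succ] at hg
    obtain ⟨t, ht, s, hs, rfl⟩ := Set.mem_mul.1 hg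
    obtain ⟨i, him, hi⟩ := ih ht
    have hs' : ∃ j : ℤ, j.natAbs ≤ 1 ∧ s.a = x ^ j := by
      rcases hs with rfl | rfl | rfl | rfl | rfl
      · exact ⟨0, by simp⟩
      · exact ⟨1, by simp⟩
      · exact ⟨-1, by simp⟩
      · exact ⟨1, by simp⟩
      · exact ⟨-1, by simp⟩
    obtain ⟨j, hj1, hj⟩ := hs'
    exact ⟨i + j, by omega, by rw [mul_a, hi, hj, zpow_add]⟩

instance : Group.IsSolvable (Aff K) := by
  have hker : Group.IsSolvable (proj (K := K)).ker := Group.isSolvable_of_comm fun g h =>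
    Subtype.ext (mul_comm_of_translation (MonoidHom.mem_ker.1 g.2) (MonoidHom.mem_ker.1 h.2))
  exact Group.isSolvable_of_ker_le_range (proj (K := K)).ker.subtype proj (by simp)

end Aff

theorem Group.fg_of_fg_ker_of_isCyclic_range {G Q : Type*} [Group G] [Group Q] (f : G →* Q)
    (hk : f.ker.FG) [IsCyclic f.range] : Group.FG G := by
  obtain ⟨S, hS, hfin⟩ := (Subgroup.fg_iff _).1 hk
  obtain ⟨⟨_, g, rfl⟩, hg⟩ := IsCyclic.exists_generator (α := f.range)
  refine Group.fg_iff.2 ⟨insert g S, ?_, hfin.insert g⟩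
  rw [eq_top_iff]
  intro y _
  obtain ⟨k, hk⟩ := Subgroup.mem_zpowers_iff.1 (hg ⟨f y, y, rfl⟩)
  have hk' : f g ^ k = f y := by simpa using congrArg Subtype.val hk
  have hgm : g ^ k ∈ Subgroup.closure (insert g S) :=
    zpow_mem (Subgroup.subset_closure (Set.mem_insert g S)) k
  have hker : (g ^ k)⁻¹ * y ∈ f.ker := by simp [MonoidHom.mem_ker, hk']
  rw [← hS] at hker
  have := mul_mem hgm (Subgroup.closure_mono (Set.subset_insert g S) hker)
  simpa using this

namespace Aff

variable {K : Type*} [Field K]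

theorem group_fg_of_le {G : Type*} [Group G] (f : G →* Aff K) (hf : Function.Injective f)
    (x : Kˣ) (M : Submodule ℤ K) (hM : M.FG) (ha : ∀ g, (f g).a ∈ Subgroup.zpowers x)
    (hb : ∀ g, (f g).b ∈ M) : Group.FG G := by
  set p : G →* Kˣ := proj.comp f
  have hrange : p.range ≤ Subgroup.zpowers x := by
    rintro _ ⟨g, rfl⟩
    exact ha g
  have hcyc : IsCyclic p.range :=
    isCyclic_of_injective (Subgroup.inclusion hrange) (Subgroup.inclusion_injective hrange)
  refine Group.fg_of_fg_ker_of_isCyclic_range p ?_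
  have hone : ∀ g : p.ker, (f g).a = 1 := fun g => MonoidHom.mem_ker.1 g.2
  let t : p.ker →* Multiplicative K :=
    { toFun := fun g => Multiplicative.ofAdd (f g).b
      map_one' := by simp
      map_mul' := fun g h => by
        rw [← ofAdd_add]
        simp [hone g, add_comm] }
  have ht : Function.Injective t := by
    intro g h hgh
    refine Subtype.ext (hf (Aff.ext ?_ ?_))
    · rw [hone g, hone h]
    · exact Multiplicative.ofAdd.injective hgh
  have htr : t.range.FG := by
    let N : Submodule ℤ K := AddSubgroup.toIntSubmodule (Subgroup.toAddSubgroup' t.range)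
    have hNM : N ≤ M := by
      rintro _ ⟨g, rfl⟩
      exact hb g
    have : IsNoetherian ℤ M := isNoetherian_of_fg_of_noetherian M hM
    have hN : N.FG := Submodule.FG.of_le hM hNM
    have hN' := (Submodule.fg_iff_addSubgroup_fg N).1 hN
    exact (AddSubgroup.fg_iff_mul_fg _).1 hN'
  rw [← Group.fg_iff_subgroup_fg]
  have : Group.FG t.range := (Group.fg_iff_subgroup_fg _).2 htr
  exact Group.fg_of_surjective (f := (MonoidHom.ofInjective ht).symm.toMonoidHom)
    (MonoidHom.ofInjective ht).symm.surjective

/-- If `x` and `x⁻¹` are both algebraic integers (with `x⁻¹ ∈ ℤ[x]`), the group generated by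
`z ↦ x z` and `z ↦ x z + 1` is polycyclic. -/
theorem polycyclic_closure (x : Kˣ) (hint : IsIntegral ℤ (x : K))
    (hinv : ((x⁻¹ : Kˣ) : K) ∈ Algebra.adjoin ℤ {(x : K)}) :
    Polycyclic (Subgroup.closure {(⟨x, 0⟩ : Aff K), ⟨x, 1⟩}) := by
  set R := Algebra.adjoin ℤ {(x : K)} with hR
  have hxR : (x : K) ∈ R := Algebra.self_mem_adjoin_singleton ℤ _
  have hmem : ∀ g ∈ Subgroup.closure {(⟨x, 0⟩ : Aff K), ⟨x, 1⟩},
      g.a ∈ Subgroup.zpowers x ∧ (g.a : K) ∈ R ∧ ((g.a⁻¹ : Kˣ) : K) ∈ R ∧ g.b ∈ R := by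
    intro g hg
    induction hg using Subgroup.closure_induction with
    | mem g hg =>
      rcases hg with rfl | rfl
      · exact ⟨Subgroup.mem_zpowers x, hxR, hinv, zero_mem R⟩
      · exact ⟨Subgroup.mem_zpowers x, hxR, hinv, one_mem R⟩
    | one => simp [one_mem, zero_mem]
    | mul g h _ _ hg hh =>
      obtain ⟨g1, g2, g3, g4⟩ := hg
      obtain ⟨h1, h2, h3, h4⟩ := hh
      refine ⟨mul_mem g1 h1, ?_, ?_, add_mem (mul_mem g2 h4) g4⟩
      · simpa using mul_mem g2 h2
      · simpa using mul_mem h3 g3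
    | inv g _ hg =>
      obtain ⟨g1, g2, g3, g4⟩ := hg
      exact ⟨inv_mem g1, g3, by simpa using g2, neg_mem (mul_mem g3 g4)⟩
  refine ⟨(inferInstance : Group.IsSolvable _), fun H => ?_⟩
  exact group_fg_of_le ((Subgroup.subtype _).comp H.subtype)
    ((Subgroup.subtype_injective _).comp H.subtype_injective) x (Subalgebra.toSubmodule R)
    hint.fg_adjoin_singleton (fun g => (hmem _ g.1.2).1) (fun g => (hmem _ g.1.2).2.2.2)

/-- A group mapping to the affine group whose image contains a homothety of infinite order and a
nontrivial translation is not nilpotent. -/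
theorem not_isNilpotent {G : Type*} [Group G] (f : G →* Aff K) {s t : G}
    (hs : (f s).a ≠ 1) (ht : (f t).a = 1) (ht0 : (f t).b ≠ 0) : ¬ Group.IsNilpotent G := by
  intro hnil
  have key : ∀ (c : ℕ) (y : G), y ∈ Subgroup.upperCentralSeries G c → (f y).a = 1 →
      (f y).b = 0 := by
    intro c
    induction c with
    | zero =>
      intro y hy _
      have : y = 1 := by simpa using hy
      simp [this]
    | succ c ih =>
      intro y hy hya
      have hcomm := ih _ (Subgroup.mem_upperCentralSeries_succ_iff.1 hy s)
        (by simp [commutatorElement_def, hya])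
      simp only [commutatorElement_def, map_mul, map_inv, mul_b, mul_a, inv_a, inv_b, hya] at hcomm
      have hmul : (f y).b * (1 - ((f s).a : K)) = 0 := by
        have h0 := (f s).a.ne_zero
        simp at hcomm
        linear_combination hcomm
      rcases mul_eq_zero.1 hmul with h | h
      · exact h
      · exact absurd (Units.ext (sub_eq_zero.1 h).symm) hs
  obtain ⟨c, hc⟩ := hnil.nilpotent'
  exact ht0 (key c t (hc ▸ Subgroup.mem_top t) ht)

theorem not_virtuallyNilpotent_s4 [CharZero K] {G : Type*} [Group G] (f : G →* Aff K) {s t : G}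
    (hs : ∀ k : ℕ, 0 < k → (f s).a ^ k ≠ 1) (ht : (f t).a = 1) (ht0 : (f t).b ≠ 0) :
    ¬ VirtuallyNilpotent G := by
  rintro ⟨H, hH, hnil⟩
  obtain ⟨k, hk, -, hsk⟩ := Subgroup.exists_pow_mem_of_index_ne_zero hH.index_ne_zero s
  obtain ⟨l, hl, -, htl⟩ := Subgroup.exists_pow_mem_of_index_ne_zero hH.index_ne_zero t
  have hb : ∀ m : ℕ, (f t ^ m).b = m * (f t).b := by
    intro m
    induction m with
    | zero => simp
    | succ m ih =>
      rw [pow_succ, mul_b, ih, pow_a, ht]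
      push_cast
      ring
  refine not_isNilpotent (f.comp H.subtype) (s := ⟨_, hsk⟩) (t := ⟨_, htl⟩) ?_ ?_ ?_ hnil
  · simpa [pow_a] using hs k hk
  · simp [pow_a, ht]
  · simpa [hb, ht0] using hl.ne'

end Aff

theorem exists_complex_root_norm_lt_one {N : ℕ} (hN : 0 < N) :
    ∃ x : ℂˣ, (x : ℂ) ^ (3 * N) + (x : ℂ) ^ N + 1 = 0 ∧ ‖(x : ℂ)‖ < 1 := by
  obtain ⟨y, hy, hy0⟩ : ∃ y ∈ Set.Ioo (-1 : ℝ) 0, y ^ 3 + y + 1 = 0 := by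
    have hcont : ContinuousOn (fun y : ℝ => y ^ 3 + y + 1) (Set.Icc (-1) 0) := by fun_prop
    exact intermediate_value_Ioo (by norm_num) hcont (by norm_num)
  obtain ⟨x, hx⟩ := IsAlgClosed.exists_pow_nat_eq (y : ℂ) hN
  have hx0 : x ≠ 0 := by
    rintro rfl
    rw [zero_pow hN.ne'] at hx
    exact hy.2.ne (by exact_mod_cast hx.symm)
  refine ⟨Units.mk0 x hx0, ?_, ?_⟩
  · rw [mul_comm, pow_mul, Units.val_mk0, hx]
    exact_mod_cast hy0
  · have hnorm : ‖x‖ ^ N < 1 := by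
      rw [← norm_pow, hx, Complex.norm_real, Real.norm_eq_abs, abs_lt]
      exact ⟨hy.1, by linarith [hy.2]⟩
    exact (pow_lt_one_iff_of_nonneg (norm_nonneg x) hN.ne').1 hnorm

/-- For every `n ≥ 1` there is a root `x` of `X^(3·n!) + X^(n!) + 1` such that the
subgroup of the affine group of the complex line generated by `z ↦ xz` and `z ↦ xz + 1` is
polycyclic, not virtually nilpotent, and contains no pair of positively independent elements in the
ball of radius `n - 1` of the generating set `{1, A, A⁻¹, B, B⁻¹}`. -/
theorem stmt_4 (n : ℕ) (hn : 1 ≤ n) :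
    ∃ x : ℂˣ, (x : ℂ) ^ (3 * Nat.factorial n) + (x : ℂ) ^ Nat.factorial n + 1 = 0 ∧
      Polycyclic (Subgroup.closure {(⟨x, 0⟩ : Aff ℂ), ⟨x, 1⟩}) ∧
      ¬ VirtuallyNilpotent (Subgroup.closure {(⟨x, 0⟩ : Aff ℂ), ⟨x, 1⟩}) ∧
      ∀ g h : Aff ℂ,
        g ∈ ({1, ⟨x, 0⟩, (⟨x, 0⟩ : Aff ℂ)⁻¹, ⟨x, 1⟩,
              (⟨x, 1⟩ : Aff ℂ)⁻¹} : Set (Aff ℂ)) ^ (n - 1) →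
        h ∈ ({1, ⟨x, 0⟩, (⟨x, 0⟩ : Aff ℂ)⁻¹, ⟨x, 1⟩,
              (⟨x, 1⟩ : Aff ℂ)⁻¹} : Set (Aff ℂ)) ^ (n - 1) →
        ¬ PosIndep g h := by
  have hN : 0 < n.factorial := n.factorial_pos
  obtain ⟨x, hx, hx1⟩ := exists_complex_root_norm_lt_one hN
  have hroot : ∀ k : ℕ, 0 < k → x ^ k ≠ 1 := by
    intro k hk h
    have h1 : ‖(x : ℂ)‖ ^ k = 1 := by
      rw [← norm_pow, ← Units.val_pow_eq_pow_val, h, Units.val_one, norm_one]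
    exact (pow_lt_one₀ (norm_nonneg _) hx1 hk.ne').ne h1
  have hball : ∀ i : ℤ, i.natAbs ≤ n - 1 → i = 0 ∨ i ∣ (n.factorial : ℤ) := by
    intro i hi
    rcases eq_or_ne i 0 with h | h
    · exact Or.inl h
    · exact Or.inr (Int.natAbs_dvd.1 (Int.natCast_dvd_natCast.2
        (Nat.dvd_factorial (by omega) (by omega))))
  refine ⟨x, hx, Aff.polycyclic_closure x ?_ ?_, ?_, ?_⟩
  · refine IsIntegral.of_pow hN ⟨Polynomial.X ^ 3 + Polynomial.X + 1, by monicity!, ?_⟩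
    rw [mul_comm, pow_mul] at hx
    simpa using hx
  · obtain ⟨N, hN'⟩ := Nat.exists_eq_succ_of_ne_zero hN.ne'
    have hxA : (x : ℂ) ∈ Algebra.adjoin ℤ {(x : ℂ)} := Algebra.self_mem_adjoin_singleton ℤ _
    have hinv : ((x⁻¹ : ℂˣ) : ℂ) = -((x : ℂ) ^ (3 * N + 2) + (x : ℂ) ^ N) := by
      rw [Units.val_inv_eq_inv_val]
      refine inv_eq_of_mul_eq_one_right ?_
      rw [hN', Nat.succ_eq_add_one] at hx
      linear_combination -hx
    rw [hinv]
    exact neg_mem (add_mem (pow_mem hxA _) (pow_mem hxA _))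
  · have hA : (⟨x, 0⟩ : Aff ℂ) ∈ Subgroup.closure {(⟨x, 0⟩ : Aff ℂ), ⟨x, 1⟩} :=
      Subgroup.subset_closure (by simp)
    have hB : (⟨x, 1⟩ : Aff ℂ) ∈ Subgroup.closure {(⟨x, 0⟩ : Aff ℂ), ⟨x, 1⟩} :=
      Subgroup.subset_closure (by simp)
    exact Aff.not_virtuallyNilpotent_s4 (Subgroup.subtype _) (s := ⟨_, hA⟩)
      (t := ⟨_, mul_mem hB (inv_mem hA)⟩) hroot (by simp) (by simp)
  · intro g h hg hh
    obtain ⟨i, hi, hgi⟩ := Aff.exists_zpow_of_mem_ball hg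
    obtain ⟨j, hj, hhj⟩ := Aff.exists_zpow_of_mem_ball hh
    exact Aff.not_posIndep_of_zpow hN hx (hball i hi) (hball j hj) hgi hhj
end

section
/- Let Γ be a finitely generated metabelian group which is not polycyclic. Then for every finite symmetric generating set Σ of Γ containing the identity, there exist two positively independent elements of Γ each of which is a product of at most 3 elements of Σ. -/
open Pointwise

open Polynomial
open scoped commutatorElement

/-- The integer polynomial `∑ εᵢ Xⁱ` attached to a word, where `εᵢ` is `0` if the `i`-th letter is
`true` and `1` if it is `false`. -/
noncomputable def wordPoly : List Bool → ℤ[X]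
  | [] => 0
  | c :: w => C (if c then 0 else 1) + X * wordPoly w

theorem coeff_wordPoly (w : List Bool) (n : ℕ) :
    (wordPoly w).coeff n = 0 ∨ (wordPoly w).coeff n = 1 := by
  induction w generalizing n with
  | nil => simp [wordPoly]
  | cons c w ih =>
    cases n with
    | zero => cases c <;> simp [wordPoly]
    | succ n => simpa only [wordPoly, coeff_add, coeff_C_succ, coeff_X_mul, zero_add] using ih n

theorem wordPoly_injective_of_length_eq {v w : List Bool} (hlen : v.length = w.length)
    (h : wordPoly v = wordPoly w) : v = w := by
  induction v generalizing w with
  | nil => exact (List.length_eq_zero_iff.1 hlen.symm).symm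
  | cons c v ih =>
    cases w with
    | nil => simp at hlen
    | cons d w =>
      have h0 := congrArg (fun p => coeff p 0) h
      have hcd : c = d := by
        cases c <;> cases d <;> simp [wordPoly] at h0 ⊢
      subst hcd
      simp only [wordPoly, add_right_inj, mul_eq_mul_left_iff, X_ne_zero, or_false] at h
      rw [ih (by simpa using hlen) h]

theorem exists_monic_of_wordPoly_sub {v w : List Bool} (hlen : v.length = w.length)
    (hne : v ≠ w) : ∃ p : ℤ[X], p.Monic ∧
      (p = wordPoly v - wordPoly w ∨ p = -(wordPoly v - wordPoly w)) := by
  have h0 : wordPoly v - wordPoly w ≠ 0 := fun h =>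
    hne (wordPoly_injective_of_length_eq hlen (sub_eq_zero.1 h))
  have hl := leadingCoeff_ne_zero.2 h0
  have hc : (wordPoly v - wordPoly w).leadingCoeff = 1 ∨
      (wordPoly v - wordPoly w).leadingCoeff = -1 := by
    generalize hn : (wordPoly v - wordPoly w).natDegree = n
    rw [leadingCoeff, hn, coeff_sub] at hl ⊢
    have hv := coeff_wordPoly v n
    have hw := coeff_wordPoly w n
    omega
  rcases hc with hc | hc
  · exact ⟨_, hc, Or.inl rfl⟩
  · exact ⟨_, by rw [Monic, leadingCoeff_neg, hc, neg_neg], Or.inr rfl⟩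

theorem exists_length_eq_of_not_injective {G : Type*} [Group G] (φ : FreeMonoid Bool →* G)
    {v w : List Bool} (hne : v ≠ w) (h : φ (FreeMonoid.ofList v) = φ (FreeMonoid.ofList w)) :
    ∃ v' w' : List Bool, v'.length = w'.length ∧ v' ≠ w' ∧
      φ (FreeMonoid.ofList v') = φ (FreeMonoid.ofList w') := by
  have nil_case : ∀ (c : Bool) (w : List Bool), φ (FreeMonoid.ofList (c :: w)) = 1 →
      ∃ v' w' : List Bool, v'.length = w'.length ∧ v' ≠ w' ∧
        φ (FreeMonoid.ofList v') = φ (FreeMonoid.ofList w') := fun c w h =>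
    ⟨(c :: w) ++ [!c], [!c] ++ (c :: w), by simp, by simp, by
      rw [FreeMonoid.ofList_append, FreeMonoid.ofList_append, map_mul, map_mul, h, one_mul,
        mul_one]⟩
  induction v generalizing w with
  | nil =>
    cases w with
    | nil => exact absurd rfl hne
    | cons c w => exact nil_case c w (by rw [← h, FreeMonoid.ofList_nil, map_one])
  | cons c v ih =>
    cases w with
    | nil => exact nil_case c v (by rw [h, FreeMonoid.ofList_nil, map_one])
    | cons d w =>
      by_cases hcd : c = d
      · subst hcd
        refine ih (w := w) (fun hvw => hne (by rw [hvw])) ?_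
        rw [FreeMonoid.ofList_cons, FreeMonoid.ofList_cons, map_mul, map_mul] at h
        exact mul_left_cancel h
      · refine ⟨(c :: v) ++ (d :: w), (d :: w) ++ (c :: v), by simp; omega, by simp [hcd], ?_⟩
        rw [FreeMonoid.ofList_append, FreeMonoid.ofList_append, map_mul, map_mul, h]

section Conjugation

open scoped IsMulCommutative

variable {G : Type*} [Group G] (A : Subgroup G) [A.Normal] [IsMulCommutative A]

/-- The action of a group by conjugation on an abelian normal subgroup, written additively. -/
def conjEnd : G →* Module.End ℤ (Additive A) where
  toFun g := (MonoidHom.toAdditive (MulAut.conjNormal g).toMonoidHom).toIntLinearMap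
  map_one' := by ext; simp
  map_mul' g h := by ext; simp

@[simp]
theorem coe_conjEnd_apply (g : G) (m : Additive A) :
    ((conjEnd A g m).toMul : G) = g * m.toMul * g⁻¹ :=
  MulAut.conjNormal_apply g m.toMul

theorem lift_eq_aeval_wordPoly_mul_pow (x : G) (b : A) (w : List Bool) :
    FreeMonoid.lift (fun c : Bool => if c then x else b * x) (FreeMonoid.ofList w) =
      (aeval (conjEnd A x) (wordPoly w) (Additive.ofMul b)).toMul * x ^ w.length := by
  induction w with
  | nil => simp [wordPoly]
  | cons c w ih =>
    rw [FreeMonoid.ofList_cons, map_mul, ih]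
    cases c <;> simp [wordPoly, pow_succ', mul_assoc]

theorem exists_monic_aeval_eq_zero_of_not_posIndep (x : G) (b : A)
    (h : ¬ PosIndep x (b * x)) :
    ∃ p : ℤ[X], p.Monic ∧ aeval (conjEnd A x) p (Additive.ofMul b) = 0 := by
  obtain ⟨v, w, hvw, hne⟩ := Function.not_injective_iff.1 h
  obtain ⟨v, w, hlen, hne, hvw⟩ := exists_length_eq_of_not_injective _
    (v := v.toList) (w := w.toList) (fun h => hne (FreeMonoid.toList.injective h)) hvw
  obtain ⟨p, hp, hpe⟩ := exists_monic_of_wordPoly_sub hlen hne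
  rw [lift_eq_aeval_wordPoly_mul_pow, lift_eq_aeval_wordPoly_mul_pow, hlen] at hvw
  have key : aeval (conjEnd A x) (wordPoly v) (Additive.ofMul b) =
      aeval (conjEnd A x) (wordPoly w) (Additive.ofMul b) :=
    Additive.toMul.injective (Subtype.ext (mul_right_cancel hvw))
  refine ⟨p, hp, ?_⟩
  rcases hpe with rfl | rfl <;> simp [key]

theorem conjEnd_comm (hA : commutator G ≤ A) (g h : G) :
    conjEnd A g * conjEnd A h = conjEnd A h * conjEnd A g := by
  have hmem : ⁅g, h⁆ ∈ A :=
    hA (Subgroup.commutator_mem_commutator (Subgroup.mem_top g) (Subgroup.mem_top h))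
  have hone : conjEnd A ⁅g, h⁆ = 1 := by
    refine LinearMap.ext fun m => ?_
    refine Additive.toMul.injective (Subtype.ext ?_)
    have hcomm := congrArg Subtype.val (mul_comm (⟨_, hmem⟩ : A) m.toMul)
    rw [Subgroup.coe_mul, Subgroup.coe_mul] at hcomm
    rw [coe_conjEnd_apply, hcomm, mul_inv_cancel_right, Module.End.one_apply]
  rw [← map_mul, ← map_mul,
    show g * h = ⁅g, h⁆ * (h * g) by simp [commutatorElement_def, mul_assoc],
    map_mul, hone, one_mul]

theorem normal_map_subtype_of_conjEnd_mem {S : Set G} (hinv : ∀ s ∈ S, s⁻¹ ∈ S)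
    (hgen : Subgroup.closure S = ⊤) (N : AddSubgroup (Additive A))
    (hN : ∀ s ∈ S, ∀ m ∈ N, conjEnd A s m ∈ N) :
    ((AddSubgroup.toSubgroup' N).map A.subtype).Normal := by
  have hmem : ∀ s ∈ S, ∀ x ∈ (AddSubgroup.toSubgroup' N).map A.subtype,
      s * x * s⁻¹ ∈ (AddSubgroup.toSubgroup' N).map A.subtype := by
    rintro s hs _ ⟨m, hm, rfl⟩
    exact ⟨(conjEnd A s (Additive.ofMul m)).toMul, hN s hs _ hm, by simp⟩
  rw [← Subgroup.normalizer_eq_top_iff, eq_top_iff, ← hgen, Subgroup.closure_le]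
  intro s hs
  refine Subgroup.mem_normalizer_iff.2 fun x => ⟨hmem s hs x, fun hx => ?_⟩
  have := hmem _ (hinv s hs) _ hx
  simpa [mul_assoc] using this

end Conjugation

theorem commutatorElement_mem_of_closure_eq_top {G : Type*} [Group G] {S : Set G}
    (hgen : Subgroup.closure S = ⊤) (K : Subgroup G) [K.Normal] (s : G)
    (hs : ∀ t ∈ S, ⁅t, s⁆ ∈ K) (g : G) : ⁅g, s⁆ ∈ K := by
  have hiff : ∀ g : G, ⁅g, s⁆ ∈ K ↔
      g ∈ (Subgroup.centralizer {(QuotientGroup.mk' K s)}).comap (QuotientGroup.mk' K) := by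
    intro g
    rw [Subgroup.mem_comap, Subgroup.mem_centralizer_singleton_iff, ← commute_iff_eq,
      ← commutatorElement_eq_one_iff_commute, ← map_commutatorElement, QuotientGroup.mk'_apply,
      QuotientGroup.eq_one_iff]
  rw [hiff]
  have hle : Subgroup.closure S ≤
      (Subgroup.centralizer {(QuotientGroup.mk' K s)}).comap (QuotientGroup.mk' K) :=
    (Subgroup.closure_le _).2 fun t ht => (hiff t).1 (hs t ht)
  exact hle (hgen ▸ Subgroup.mem_top g)

/-- A finite module over a ring finitely generated by `T` is finitely generated over `ℤ` as soon
as each element of `T` satisfies a monic equation at some nonzero element of each nonzero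
quotient. -/
theorem Module.finite_int_of_exists_monic {R M : Type*} [CommRing R] [AddCommGroup M] [Module R M]
    [Module.Finite R M] (T : Set R) (hT : T.Finite) (htop : Algebra.adjoin ℤ T = ⊤)
    (h : ∀ N : Submodule R M, N ≠ ⊤ → ∀ t ∈ T, ∃ p : ℤ[X], p.Monic ∧
      ∃ m ∉ N, aeval t p • m ∈ N) : Module.Finite ℤ M := by
  have hft : Algebra.FiniteType ℤ R := ⟨⟨hT.toFinset, by simpa using htop⟩⟩
  have : IsNoetherianRing R := Algebra.FiniteType.isNoetherianRing ℤ R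
  have : IsNoetherian R M := inferInstance
  by_contra hM
  obtain ⟨N, hN, hmax⟩ := set_has_maximal_iff_noetherian.2 this
    {N : Submodule R M | ¬ Module.Finite ℤ (M ⧸ N)}
    ⟨⊥, fun hfin => hM (Module.Finite.equiv
      ((Submodule.quotEquivOfEqBot (⊥ : Submodule R M) rfl).restrictScalars ℤ))⟩
  have hNtop : N ≠ ⊤ := by
    rintro rfl
    have : Subsingleton (M ⧸ (⊤ : Submodule R M)) := Submodule.Quotient.subsingleton_iff.2 rfl
    exact hN inferInstance
  have dichotomy : ∀ r : R, (∃ m ∉ N, r • m ∈ N) → ∀ m, r • m ∈ N := by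
    rintro r ⟨m₀, hm₀, hr₀⟩
    by_contra! hr
    obtain ⟨m₁, hm₁⟩ := hr
    let K := N.comap (LinearMap.lsmul R M r)
    let L := N ⊔ LinearMap.range (LinearMap.lsmul R M r)
    have hNK : N < K := lt_of_le_of_ne (fun m hm => N.smul_mem r hm)
      fun hK => hm₀ (hK ▸ (show m₀ ∈ K from hr₀))
    have hNL : N < L := lt_of_le_of_ne le_sup_left
      fun hL => hm₁ (hL ▸ (show r • m₁ ∈ L from Submodule.mem_sup_right ⟨m₁, rfl⟩))
    have hfinK : Module.Finite ℤ (M ⧸ K) := not_not.1 fun hK => hmax K hK hNK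
    have hfinL : Module.Finite ℤ (M ⧸ L) := not_not.1 fun hL => hmax L hL hNL
    let g : (M ⧸ K) →ₗ[ℤ] (M ⧸ N) := (K.mapQ N (LinearMap.lsmul R M r) le_rfl).restrictScalars ℤ
    let f : (M ⧸ N) →ₗ[ℤ] (M ⧸ L) := (Submodule.factor hNL.le).restrictScalars ℤ
    refine hN ⟨Submodule.fg_of_fg_map_of_fg_inf_ker f (IsNoetherian.noetherian _) ?_⟩
    have hker : ⊤ ⊓ LinearMap.ker f ≤ LinearMap.range g := by
      rintro x ⟨-, hx⟩
      obtain ⟨m, rfl⟩ := N.mkQ_surjective x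
      have hmL : m ∈ L := (Submodule.Quotient.mk_eq_zero L).1 hx
      obtain ⟨n, hn, _, ⟨k, rfl⟩, rfl⟩ := Submodule.mem_sup.1 hmL
      refine ⟨K.mkQ k, ((Submodule.Quotient.eq N).2 ?_).symm⟩
      simpa using hn
    have hrange : IsNoetherian ℤ (LinearMap.range g) := inferInstance
    exact Submodule.FG.of_le (Module.Finite.iff_fg.1 inferInstance) hker
  have hintegral : ∀ t ∈ T, IsIntegral ℤ (Ideal.Quotient.mk (Module.annihilator R (M ⧸ N)) t) := by
    intro t ht
    obtain ⟨p, hp, hm⟩ := h N hNtop t ht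
    refine ⟨p, hp, ?_⟩
    rw [← aeval_def, ← Ideal.Quotient.mkₐ_eq_mk ℤ, aeval_algHom_apply, Ideal.Quotient.mkₐ_eq_mk,
      Ideal.Quotient.eq_zero_iff_mem, Module.mem_annihilator]
    intro x
    obtain ⟨m, rfl⟩ := N.mkQ_surjective x
    exact (Submodule.Quotient.mk_eq_zero N).2 (dichotomy _ hm m)
  let I := Module.annihilator R (M ⧸ N)
  have hquot : Module.Finite ℤ (R ⧸ I) := by
    have hadj : Algebra.adjoin ℤ (Ideal.Quotient.mkₐ ℤ I '' T) = ⊤ := by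
      rw [← AlgHom.map_adjoin, htop, Algebra.map_top, AlgHom.range_eq_top]
      exact Ideal.Quotient.mkₐ_surjective ℤ I
    have hfg := fg_adjoin_of_finite (R := ℤ) (hT.image (Ideal.Quotient.mkₐ ℤ I)) (by
      rintro _ ⟨t, ht, rfl⟩
      exact hintegral t ht)
    rw [hadj] at hfg
    exact ⟨hfg⟩
  let _ : Module (R ⧸ I) (M ⧸ N) := Module.quotientAnnihilator
  have htower : IsScalarTower R (R ⧸ I) (M ⧸ N) := inferInstance
  have : Module.Finite (R ⧸ I) (M ⧸ N) := Module.Finite.of_restrictScalars_finite R _ _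
  exact hN (Module.Finite.trans (R ⧸ I) (M ⧸ N))

theorem Group.fg_of_fg_ker_of_fg_range {G Q : Type*} [Group G] [Group Q] (f : G →* Q)
    (hker : f.ker.FG) (hrange : f.range.FG) : Group.FG G := by
  rw [Group.fg_def]
  obtain ⟨S, hS⟩ := hker
  obtain ⟨T, hT⟩ := hrange
  have hT' : ∀ t : T, ∃ g, f g = t := fun t => by
    have : (t : Q) ∈ f.range := hT ▸ Subgroup.subset_closure t.2
    exact this
  choose g hg using hT'
  refine (Subgroup.fg_iff _).2 ⟨S ∪ Set.range g, ?_, S.finite_toSet.union (Set.finite_range g)⟩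
  rw [Subgroup.closure_union, hS, sup_comm, eq_top_iff, ← Subgroup.map_le_map_iff,
    ← MonoidHom.range_eq_map, ← hT, Subgroup.closure_le]
  exact fun t ht => ⟨g ⟨t, ht⟩, Subgroup.subset_closure ⟨_, rfl⟩, hg _⟩

theorem Group.fg_subgroup_of_commGroup {Q : Type*} [CommGroup Q] [Group.FG Q] (H : Subgroup Q) :
    Group.FG H := by
  have : Module.Finite ℤ (Additive Q) := Module.Finite.iff_addGroup_fg.2 inferInstance
  have hfg := (inferInstance : IsNoetherian ℤ (Additive Q)).noetherian
    (AddSubgroup.toIntSubmodule H.toAddSubgroup)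
  rw [Group.fg_iff_subgroup_fg, Subgroup.fg_iff_add_fg]
  rw [Submodule.fg_iff_addSubgroup_fg] at hfg
  exact hfg

theorem Metabelian.polycyclic {G : Type*} [Group G] [Group.FG G] (hmeta : Metabelian G)
    (hfg : Group.FG (commutator G)) : Polycyclic G := by
  let _ : CommGroup (commutator G) := { mul_comm := hmeta }
  refine ⟨Group.isSolvable_of_ker_le_range (commutator G).subtype Abelianization.of
    (by rw [Abelianization.ker_of, Subgroup.range_subtype]), fun H => ?_⟩
  refine Group.fg_of_fg_ker_of_fg_range (Abelianization.of.comp H.subtype) ?_ ?_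
  · rw [← Group.fg_iff_subgroup_fg]
    let K := (Abelianization.of.comp H.subtype).ker
    have hK : ∀ k : K, ((k : H) : G) ∈ commutator G := fun k => by
      rw [← Abelianization.ker_of]
      exact k.2
    let f : K →* commutator G := (H.subtype.comp K.subtype).codRestrict _ hK
    have hf : Function.Injective f := fun a b hab => by
      have hval : ((a : H) : G) = b := congrArg (Subtype.val : commutator G → G) hab
      exact Subtype.ext (Subtype.ext hval)
    have : Group.FG f.range := Group.fg_subgroup_of_commGroup _
    exact Group.fg_of_surjective (f := (MonoidHom.ofInjective hf).symm.toMonoidHom)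
      (MonoidHom.ofInjective hf).symm.surjective
  · have : Group.FG (Abelianization G) :=
      Group.fg_of_surjective (f := Abelianization.of) Quotient.mk_surjective
    exact (Group.fg_iff_subgroup_fg _).1 (Group.fg_subgroup_of_commGroup _)

open scoped IsMulCommutative in
/-- If a metabelian group has a finite symmetric generating set whose triple products contain no
positively independent pair, then its commutator subgroup is finitely generated. -/
theorem Metabelian.fg_commutator_of_not_posIndep {G : Type*} [Group G] (hmeta : Metabelian G)
    (S : Finset G) (h1 : (1 : G) ∈ S) (hinv : ∀ s ∈ S, s⁻¹ ∈ S)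
    (hgen : Subgroup.closure (S : Set G) = ⊤)
    (hno : ∀ x y : G, x ∈ (S : Set G) ^ 3 → y ∈ (S : Set G) ^ 3 → ¬ PosIndep x y) :
    Group.FG (commutator G) := by
  have : IsMulCommutative (commutator G) := ⟨⟨hmeta⟩⟩
  let A := commutator G
  have hmem : ∀ g h : G, ⁅g, h⁆ ∈ A := fun g h =>
    Subgroup.commutator_mem_commutator (Subgroup.mem_top g) (Subgroup.mem_top h)
  have hcomm : ∀ a ∈ conjEnd A '' S, ∀ b ∈ conjEnd A '' S, a * b = b * a := by
    rintro _ ⟨g, -, rfl⟩ _ ⟨h, -, rfl⟩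
    exact conjEnd_comm A le_rfl g h
  let R := Algebra.adjoin ℤ (conjEnd A '' (S : Set G))
  have : IsMulCommutative R := Algebra.isMulCommutative_adjoin ℤ hcomm
  have hnormal : ∀ N : Submodule R (Additive A),
      ((AddSubgroup.toSubgroup' N.toAddSubgroup).map A.subtype).Normal := fun N =>
    normal_map_subtype_of_conjEnd_mem A hinv hgen _ fun s hs m hm =>
      N.smul_mem (⟨conjEnd A s, Algebra.subset_adjoin ⟨s, hs, rfl⟩⟩ : R) hm
  have hmap : ∀ (N : Submodule R (Additive A)) (a : A),
      (a : G) ∈ (AddSubgroup.toSubgroup' N.toAddSubgroup).map A.subtype ↔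
        Additive.ofMul a ∈ N := fun N a =>
    Subgroup.mem_map_iff_mem A.subtype_injective
  have hspan : Submodule.span R
      ((fun g : G × G => Additive.ofMul (⟨⁅g.1, g.2⁆, hmem g.1 g.2⟩ : A)) ''
        ((S : Set G) ×ˢ (S : Set G))) = ⊤ := by
    generalize hN : Submodule.span R (M := Additive A) _ = N
    have := hnormal N
    have hSS : ∀ t ∈ S, ∀ s ∈ S, ⁅t, s⁆ ∈
        (AddSubgroup.toSubgroup' N.toAddSubgroup).map A.subtype := fun t ht s hs =>
      (hmap N ⟨_, hmem t s⟩).2 (hN ▸ Submodule.subset_span ⟨(t, s), ⟨ht, hs⟩, rfl⟩)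
    have hall : ∀ g h : G, ⁅g, h⁆ ∈
        (AddSubgroup.toSubgroup' N.toAddSubgroup).map A.subtype := fun g h =>
      commutatorElement_mem_of_closure_eq_top hgen _ h (fun t ht => by
        rw [← commutatorElement_inv, inv_mem_iff]
        exact commutatorElement_mem_of_closure_eq_top hgen _ t (fun s hs => hSS s hs t ht) h) g
    have hle : A ≤ (AddSubgroup.toSubgroup' N.toAddSubgroup).map A.subtype :=
      Subgroup.commutator_le.2 fun g _ h _ => hall g h
    exact eq_top_iff.2 fun m _ => (hmap N m.toMul).1 (hle m.toMul.2)
  have : Module.Finite R (Additive A) :=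
    ⟨Submodule.fg_def.2 ⟨_, (S.finite_toSet.prod S.finite_toSet).image _, hspan⟩⟩
  have hfin : Module.Finite ℤ (Additive A) := by
    refine Module.finite_int_of_exists_monic (R := R)
      (Subtype.val ⁻¹' (conjEnd A '' (S : Set G)))
      ((S.finite_toSet.image _).preimage Subtype.val_injective.injOn)
      Algebra.adjoin_adjoin_coe_preimage ?_
    rintro N hN ⟨_, _⟩ ⟨s, hs, rfl⟩
    have := hnormal N
    by_cases hcent : ∀ t ∈ S, ⁅t, s⁆ ∈
        (AddSubgroup.toSubgroup' N.toAddSubgroup).map A.subtype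
    · obtain ⟨m, hm⟩ : ∃ m, m ∉ N := by
        by_contra! h
        exact hN (eq_top_iff.2 fun m _ => h m)
      refine ⟨X - C 1, monic_X_sub_C 1, m, hm, ?_⟩
      have hms := commutatorElement_mem_of_closure_eq_top hgen _ s hcent (m.toMul : G)
      rw [← commutatorElement_inv, inv_mem_iff] at hms
      convert (hmap N ⟨_, hmem s (m.toMul : G)⟩).1 hms using 1
      rw [aeval_sub, aeval_X, aeval_C, map_one, sub_smul, one_smul]
      refine Additive.toMul.injective (Subtype.ext ?_)
      rw [toMul_sub, Subgroup.coe_div, div_eq_mul_inv]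
      exact congrArg (· * (m.toMul : G)⁻¹) (coe_conjEnd_apply A s m)
    · push Not at hcent
      obtain ⟨t, ht, hts⟩ := hcent
      have hx : s ∈ (S : Set G) ^ 3 := by
        rw [show s = s * 1 * 1 by simp, pow_succ, pow_two]
        exact Set.mul_mem_mul (Set.mul_mem_mul hs h1) h1
      have hy : ⁅t, s⁆ * s ∈ (S : Set G) ^ 3 := by
        rw [show ⁅t, s⁆ * s = t * s * t⁻¹ by simp [commutatorElement_def], pow_succ, pow_two]
        exact Set.mul_mem_mul (Set.mul_mem_mul ht hs) (hinv t ht)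
      obtain ⟨p, hp, hpz⟩ := exists_monic_aeval_eq_zero_of_not_posIndep A s ⟨_, hmem t s⟩
        (hno s _ hx hy)
      refine ⟨p, hp, Additive.ofMul ⟨_, hmem t s⟩, fun h => hts ((hmap N _).2 h), ?_⟩
      convert N.zero_mem
      rw [← hpz, Subalgebra.smul_def, Polynomial.aeval_subalgebra_coe]
      rfl
  exact GroupFG.iff_add_fg.2 (Module.Finite.iff_addGroup_fg.1 hfin)

/-- A finitely generated metabelian group which is not polycyclic has positive
independence diameter at most `3`. -/
theorem stmt_5 (Γ : Type*) [Group Γ] [Group.FG Γ] (hmeta : Metabelian Γ)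
    (hnp : ¬ Polycyclic Γ) :
    ∀ S : Finset Γ, (1 : Γ) ∈ S → (∀ s ∈ S, s⁻¹ ∈ S) → Subgroup.closure (S : Set Γ) = ⊤ →
      ∃ x y : Γ, x ∈ (S : Set Γ) ^ 3 ∧ y ∈ (S : Set Γ) ^ 3 ∧ PosIndep x y := by
  intro S h1 hinv hgen
  by_contra! hno
  exact hnp (hmeta.polycyclic (hmeta.fg_commutator_of_not_posIndep S h1 hinv hgen hno))
end

section
/- Let H be a finitely generated metabelian group. Then there exists a field K and a group homomorphism ρ from H to the affine group 𝔸(K) = K ⋊ Kˣ such that: if H is not virtually nilpotent then the image ρ(H) is not virtually nilpotent, and if H is not polycyclic then ρ(H) is not polycyclic. -/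
open Pointwise

open TensorProduct in
/-- A point `p` of the support of a finite module gives a nonzero functional with values in the
residue field at `p`. -/
theorem exists_ne_zero_linearMap_residueField {R V : Type*} [CommRing R] [AddCommGroup V]
    [Module R V] [Module.Finite R V] (p : PrimeSpectrum R) (hp : p ∈ Module.support R V) :
    ∃ f : V →ₗ[R] p.asIdeal.ResidueField, f ≠ 0 := by
  rw [Module.mem_support_iff_nontrivial_residueField_tensorProduct] at hp
  obtain ⟨x, hx⟩ := exists_ne (0 : p.asIdeal.ResidueField ⊗[R] V)
  by_contra! h
  refine hx ((Module.forall_dual_apply_eq_zero_iff p.asIdeal.ResidueField x).mp fun φ => ?_)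
  clear hx
  induction x with
  | zero => exact map_zero φ
  | add x y hx hy => rw [map_add, hx, hy, add_zero]
  | tmul a v =>
    have := DFunLike.congr_fun (h (φ.restrictScalars R ∘ₗ TensorProduct.mk R _ V 1)) v
    rw [← mul_one a, ← smul_eq_mul, ← TensorProduct.smul_tmul', map_smul]
    simpa using Or.inr this

/-- A finite module over a Noetherian ring is finite over `ℤ` as soon as `R ⧸ p` is for all primes
`p` in its support. -/
theorem Module.finite_int_of_forall_mem_support {R V : Type*} [CommRing R] [IsNoetherianRing R]
    [AddCommGroup V] [Module R V] [Module.Finite R V]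
    (h : ∀ p ∈ Module.support R V, Module.Finite ℤ (R ⧸ p.asIdeal)) : Module.Finite ℤ V := by
  revert h
  induction ‹Module.Finite R V› using
    IsNoetherianRing.induction_on_isQuotientEquivQuotientPrime R with
  | subsingleton N => intro _; infer_instance
  | quotient N p e =>
    intro h
    have : p ∈ Module.support R N := by
      rw [e.support_eq, Module.support_eq_zeroLocus, Ideal.annihilator_quotient]
      exact fun _ hx => hx
    have := h p this
    exact Module.Finite.equiv (e.symm.restrictScalars ℤ)
  | exact N₁ N₂ N₃ f g hf hg hfg h₁ h₃ =>
    intro h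
    have h₁ := h₁ fun p hp => h p (Module.support_subset_of_injective f hf hp)
    have h₃ := h₃ fun p hp => h p (Module.support_subset_of_surjective g hg hp)
    exact Module.Finite.of_exact (f := f.restrictScalars ℤ) (g := g.restrictScalars ℤ) hfg hg

/-- If a nonzero functional with values in the residue field at `p` has range finitely generated
over `ℤ`, then `R ⧸ p` is finite over `ℤ`. -/
theorem Module.finite_int_quotient_of_range {R V : Type*} [CommRing R]
    [AddCommGroup V] [Module R V] (p : Ideal R) [p.IsPrime] (f : V →ₗ[R] p.ResidueField)
    (hf : f ≠ 0) (h : Module.Finite ℤ (LinearMap.range (f.restrictScalars ℤ))) :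
    Module.Finite ℤ (R ⧸ p) := by
  obtain ⟨v, hv⟩ := DFunLike.ne_iff.mp hf
  let g : R →ₗ[R] p.ResidueField := f ∘ₗ LinearMap.toSpanSingleton R V v
  have hg : LinearMap.ker g = p := by
    ext r
    have : f v ≠ 0 := hv
    simp [g, Algebra.smul_def, this, Ideal.algebraMap_residueField_eq_zero]
  have : Module.Finite ℤ (LinearMap.range (g.restrictScalars ℤ)) := by
    have := isNoetherian_of_isNoetherianRing_of_finite ℤ (LinearMap.range (f.restrictScalars ℤ))
    have hle : LinearMap.range (g.restrictScalars ℤ) ≤ LinearMap.range (f.restrictScalars ℤ) := by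
      rintro _ ⟨r, rfl⟩
      exact ⟨r • v, rfl⟩
    exact Module.Finite.of_injective (Submodule.inclusion hle) (Submodule.inclusion_injective hle)
  have : Module.Finite ℤ (LinearMap.range g) := this
  exact Module.Finite.equiv (((Submodule.quotEquivOfEq _ _ hg).symm.trans
    g.quotKerEquivRange).symm.restrictScalars ℤ)

open MonoidAlgebra in
/-- If `Q` has finite image in the residue field at `p`, then `ℤ[Q] ⧸ p` is finite over `ℤ`. -/
theorem MonoidAlgebra.finite_int_quotient {Q : Type*} [CommGroup Q]
    (p : Ideal (MonoidAlgebra ℤ Q)) [p.IsPrime]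
    (h : (Set.range fun q : Q => algebraMap _ p.ResidueField (of ℤ Q q)).Finite) :
    Module.Finite ℤ (MonoidAlgebra ℤ Q ⧸ p) := by
  have hfin : (Set.range fun q : Q => Ideal.Quotient.mk p (of ℤ Q q)).Finite := by
    refine Set.Finite.of_finite_image (f := algebraMap _ p.ResidueField) ?_
      (Ideal.injective_algebraMap_quotient_residueField p).injOn
    rw [← Set.range_comp]
    exact h
  refine ⟨⟨hfin.toFinset, ?_⟩⟩
  rw [Set.Finite.coe_toFinset, eq_top_iff]
  rintro x -
  obtain ⟨x, rfl⟩ := Ideal.Quotient.mk_surjective x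
  induction x using MonoidAlgebra.induction_on with
  | of q => exact Submodule.subset_span ⟨q, rfl⟩
  | add x y hx hy => rw [map_add]; exact add_mem hx hy
  | smul r x hx => rw [map_zsmul]; exact Submodule.smul_mem _ r hx

namespace Aff

open scoped commutatorElement

variable {K : Type*} [Field K]

theorem not_isNilpotent_of_mem {Γ : Subgroup (Aff K)} {t g : Aff K} (ht : t ∈ Γ) (hta : t.a = 1)
    (htb : t.b ≠ 0) (hg : g ∈ Γ) (hga : g.a ≠ 1) : ¬ Group.IsNilpotent Γ := by
  rw [Subgroup.isNilpotent_iff_lowerCentralSeries]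
  rintro ⟨n, hn⟩
  have h1 : (g.a : K) ≠ 1 := by simpa using hga
  have key : ∀ k, ∃ x ∈ Γ.lowerCentralSeries k, x.a = 1 ∧ x.b ≠ 0 := by
    intro k
    induction k with
    | zero => exact ⟨t, ht, hta, htb⟩
    | succ k ih =>
      obtain ⟨x, hx, hxa, hxb⟩ := ih
      refine ⟨⁅x, g⁆, Subgroup.commutator_mem_commutator hx hg, ?_, ?_⟩
      · simp [commutatorElement_def, hxa]
      · have : ⁅x, g⁆.b = (1 - g.a) * x.b := by
          simp [commutatorElement_def, hxa]
          ring
        rw [this]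
        exact mul_ne_zero (sub_ne_zero.mpr h1.symm) hxb
  obtain ⟨x, hx, -, hxb⟩ := key n
  rw [hn, Subgroup.mem_bot] at hx
  simp [hx] at hxb

/-- A subgroup of the affine group containing a nontrivial translation and with infinite linear
part is not virtually nilpotent. -/
theorem not_virtuallyNilpotent_s7 {Γ : Subgroup (Aff K)} {t : Aff K} (ht : t ∈ Γ) (hta : t.a = 1)
    (htb : t.b ≠ 0) (hinf : Infinite (Γ.map proj)) : ¬ VirtuallyNilpotent Γ := by
  rintro ⟨L, hL, hnil⟩
  have hnil' : Group.IsNilpotent (L.map Γ.subtype) :=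
    (Group.isNilpotent_congr (L.equivMapOfInjective _ Γ.subtype_injective)).mp hnil
  obtain ⟨g, hg, hga⟩ : ∃ g ∈ L, g.1.a ≠ 1 := by
    by_contra! h
    have hker : L ≤ (proj.comp Γ.subtype).ker := fun g hg => h g hg
    have := Subgroup.finiteIndex_of_le hker
    have h1 := this.index_ne_zero
    rw [Subgroup.index_ker, MonoidHom.range_comp, Subgroup.range_subtype] at h1
    exact h1 Nat.card_eq_zero_of_infinite
  have hconj : ∀ u : Γ.map proj, ∃ g ∈ Γ, g.a = u.1 ∧ (⟨1, (u.1 : K) * t.b⟩ : Aff K) ∈ Γ := by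
    rintro ⟨_, g, hg, rfl⟩
    refine ⟨g, hg, rfl, ?_⟩
    convert Γ.mul_mem (Γ.mul_mem hg ht) (Γ.inv_mem hg) using 1
    ext <;> simp [hta, proj]
  choose _ _ _ hconj using hconj
  obtain ⟨u, v, huv, heq⟩ := Finite.exists_ne_map_eq_of_infinite
    fun u : Γ.map proj => (QuotientGroup.mk (s := L) ⟨_, hconj u⟩)
  rw [QuotientGroup.eq] at heq
  refine not_isNilpotent_of_mem (Subgroup.mem_map_of_mem _ heq) ?_ ?_
    (Subgroup.mem_map_of_mem Γ.subtype hg) hga hnil'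
  · simp
  · have : (v.1 : K) - u.1 ≠ 0 := by
      rw [sub_ne_zero]
      exact fun h => huv (Subtype.ext (Units.ext h.symm))
    have h2 := mul_ne_zero this htb
    rw [sub_mul, sub_eq_neg_add] at h2
    simpa [add_comm] using h2

/-- The affine representation of `H` given by a character `χ` and an `H`-equivariant functional `f`
on a normal abelian subgroup containing all commutators, normalized to fix the origin at `h₀`. -/
theorem exists_monoidHom {H V : Type*} [Group H] [AddCommGroup V]
    (ι : Multiplicative V →* H) (hcomm : commutator H ≤ ι.range)
    (χ : H →* Kˣ) (f : V →+ K)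
    (hf : ∀ h v w, ι (.ofAdd w) = h * ι (.ofAdd v) * h⁻¹ → f w = χ h * f v)
    {h₀ : H} (h₀χ : χ h₀ ≠ 1) :
    ∃ ρ : H →* Aff K, (∀ h, (ρ h).a = χ h) ∧ ∀ v, (ρ (ι (.ofAdd v))).b = f v := by
  have hmem : ∀ h, ∃ v : V, ι (.ofAdd v) = ⁅h₀, h⁆ := fun h =>
    hcomm (Subgroup.commutator_mem_commutator (Subgroup.mem_top _) (Subgroup.mem_top _))
  choose κ hκ using hmem
  have h1 : (χ h₀ : K) - 1 ≠ 0 := sub_ne_zero.mpr (by simpa using h₀χ)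
  have hmul : ∀ g h, f (κ (g * h)) = χ g * f (κ h) + f (κ g) := by
    intro g h
    have : ι (.ofAdd (κ (g * h) - κ g)) = g * ι (.ofAdd (κ h)) * g⁻¹ := by
      rw [sub_eq_neg_add, ofAdd_add, map_mul, ofAdd_neg, map_inv, hκ, hκ, hκ]
      simp only [commutatorElement_def]
      group
    have := hf _ _ _ this
    rw [map_sub] at this
    linear_combination this
  refine ⟨MonoidHom.mk' (fun h => ⟨χ h, f (κ h) / (χ h₀ - 1)⟩) fun g h => ?_, fun h => rfl, ?_⟩
  · ext
    · simp
    · simp only [mul_b, hmul]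
      ring
  · intro v
    change f (κ (ι (.ofAdd v))) / _ = _
    rw [div_eq_iff h1]
    have : ι (.ofAdd (κ (ι (.ofAdd v)) + v)) = h₀ * ι (.ofAdd v) * h₀⁻¹ := by
      rw [ofAdd_add, map_mul, hκ, commutatorElement_def]
      group
    have := hf _ _ _ this
    rw [map_add] at this
    linear_combination this

/-- If the image of an affine representation is polycyclic, then so is its translation part. -/
theorem fg_range_of_polycyclic {H V : Type*} [Group H] [AddCommGroup V]
    (ι : Multiplicative V →* H) (f : V →+ K) (ρ : H →* Aff K) (ha : ∀ v, (ρ (ι v)).a = 1)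
    (hb : ∀ v, (ρ (ι (.ofAdd v))).b = f v) (h : Polycyclic ρ.range) : AddGroup.FG f.range := by
  let S : Subgroup ρ.range := (ρ.rangeRestrict.comp ι).range
  have hS : Group.FG S := h.2 S
  have hSa : ∀ x : S, x.1.1.a = 1 := by
    rintro ⟨_, v, rfl⟩
    exact ha v
  let τ : S →* Multiplicative f.range := MonoidHom.mk' (fun x => .ofAdd ⟨x.1.1.b, by
    obtain ⟨_, v, rfl⟩ := x
    exact ⟨v.toAdd, (hb v.toAdd).symm⟩⟩) (by
      intro x y
      refine congrArg Multiplicative.ofAdd (Subtype.ext ?_)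
      change (x.1.1 * y.1.1).b = x.1.1.b + y.1.1.b
      rw [mul_b, hSa, Units.val_one, one_mul, add_comm])
  have hτ : Function.Surjective τ := by
    rintro ⟨_, v, rfl⟩
    exact ⟨⟨_, Multiplicative.ofAdd v, rfl⟩, congrArg Multiplicative.ofAdd (Subtype.ext (hb v))⟩
  have := Group.fg_of_surjective hτ
  exact AddGroup.fg_iff_mul_fg.mpr this

end Aff

theorem Subgroup.FG.map_monoidHom {G G' : Type*} [Group G] [Group G'] {L : Subgroup G} (h : L.FG)
    (f : G →* G') : (L.map f).FG := by
  classical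
  obtain ⟨S, rfl⟩ := h
  exact ⟨S.image f, by rw [Finset.coe_image, MonoidHom.map_closure]⟩

theorem Subgroup.fg_of_commGroup {A : Type*} [CommGroup A] [Group.FG A] (L : Subgroup A) :
    L.FG := by
  have : Module.Finite ℤ (Additive A) := Module.Finite.iff_addGroup_fg.mpr inferInstance
  have := (isNoetherian_of_isNoetherianRing_of_finite ℤ (Additive A)).noetherian
    (AddSubgroup.toIntSubmodule L.toAddSubgroup)
  rw [Submodule.fg_iff_addSubgroup_fg] at this
  exact (Subgroup.fg_iff_add_fg L).mpr this

/-- A subgroup `L` is finitely generated if its image under `π` and its intersection with the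
kernel of `π` are. -/
theorem Subgroup.fg_of_fg_map_of_fg_inf_ker {G G' : Type*} [Group G] [Group G'] (π : G →* G')
    (L : Subgroup G) (h₁ : (L.map π).FG) (h₂ : (L ⊓ π.ker).FG) : L.FG := by
  classical
  obtain ⟨S, hS⟩ := h₁
  have hSL : (S : Set G') ⊆ π '' L := by
    rw [← Subgroup.coe_map, ← hS]
    exact Subgroup.subset_closure
  obtain ⟨T, hTL, rfl⟩ := Finset.subset_set_image_iff.mp hSL
  have hL : L = Subgroup.closure T ⊔ L ⊓ π.ker := by
    apply le_antisymm
    · intro x hx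
      have : π x ∈ (Subgroup.closure (T : Set G)).map π := by
        rw [MonoidHom.map_closure, ← Finset.coe_image, hS]
        exact Subgroup.mem_map_of_mem π hx
      obtain ⟨y, hy, hyx⟩ := this
      have hyL := (Subgroup.closure_le L).mpr hTL hy
      rw [← mul_inv_cancel_left y x]
      refine Subgroup.mul_mem_sup hy ⟨L.mul_mem (L.inv_mem hyL) hx, ?_⟩
      simp [hyx]
    · exact sup_le ((Subgroup.closure_le L).mpr hTL) inf_le_left
  rw [hL]
  exact Subgroup.FG.sup ⟨T, rfl⟩ h₂

/-- `ι` and `π` exhibit the group `H` as an extension of `Q` by the `ℤ[Q]`-module `V`, with `V`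
corresponding to the commutator subgroup of `H`. -/
structure IsDerivedExtension {H V Q : Type*} [Group H] [CommGroup Q] [AddCommGroup V]
    [Module (MonoidAlgebra ℤ Q) V] (ι : Multiplicative V →* H) (π : H →* Q) : Prop where
  injective : Function.Injective ι
  range_eq : ι.range = commutator H
  ker_eq : π.ker = commutator H
  surjective : Function.Surjective π
  conj : ∀ h v, ι (.ofAdd (MonoidAlgebra.of ℤ Q (π h) • v)) = h * ι (.ofAdd v) * h⁻¹

namespace IsDerivedExtension

open scoped commutatorElement

variable {H V Q : Type*} [Group H] [CommGroup Q] [AddCommGroup V]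
  [Module (MonoidAlgebra ℤ Q) V] {ι : Multiplicative V →* H} {π : H →* Q}

theorem commutator_mem_range (E : IsDerivedExtension ι π) (g h : H) :
    ⁅g, h⁆ ∈ ι.range := by
  rw [E.range_eq]
  exact Subgroup.commutator_mem_commutator (Subgroup.mem_top _) (Subgroup.mem_top _)

theorem finite [Group.FG H] (E : IsDerivedExtension ι π) : Module.Finite (MonoidAlgebra ℤ Q) V := by
  obtain ⟨S, hS, hfin⟩ := Group.fg_iff.mp ‹Group.FG H›
  choose κ hκ using E.commutator_mem_range
  let N : Submodule (MonoidAlgebra ℤ Q) V :=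
    Submodule.span _ (Set.image2 (fun s t => (κ s t).toAdd) S S)
  have hN : N.FG := Submodule.fg_span (hfin.image2 _ hfin)
  let M : Subgroup H := N.toAddSubgroup.toSubgroup.map ι
  have hnorm : M.Normal := ⟨by
    rintro _ ⟨v, hv, rfl⟩ h
    exact ⟨.ofAdd (MonoidAlgebra.of ℤ Q (π h) • v.toAdd), N.smul_mem _ hv, E.conj h v.toAdd⟩⟩
  have hcomm : commutator H ≤ M := by
    have hcl : Subgroup.closure (QuotientGroup.mk' M '' S) = ⊤ := by
      rw [← MonoidHom.map_closure, hS, ← MonoidHom.range_eq_map,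
        MonoidHom.range_eq_top.mpr (QuotientGroup.mk'_surjective M)]
    have hc := Subgroup.isMulCommutative_closure (k := QuotientGroup.mk' M '' S) (by
      rintro _ ⟨s, hs, rfl⟩ _ ⟨t, ht, rfl⟩
      rw [← commutatorElement_eq_one_iff_mul_comm, ← map_commutatorElement,
        QuotientGroup.mk'_apply, QuotientGroup.eq_one_iff]
      have hmem : (κ s t).toAdd ∈ N := Submodule.subset_span ⟨s, hs, t, ht, rfl⟩
      exact ⟨κ s t, hmem, hκ s t⟩)
    rw [hcl] at hc
    rw [commutator_def, Subgroup.commutator_le]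
    intro g _ h _
    rw [← QuotientGroup.eq_one_iff, ← QuotientGroup.mk'_apply, map_commutatorElement,
      commutatorElement_eq_one_iff_mul_comm]
    exact congrArg Subtype.val (hc.is_comm.comm ⟨QuotientGroup.mk' M g, Subgroup.mem_top _⟩
      ⟨QuotientGroup.mk' M h, Subgroup.mem_top _⟩)
  refine ⟨?_⟩
  convert hN
  rw [eq_comm, eq_top_iff]
  intro v _
  have hv : ι (.ofAdd v) ∈ M := hcomm (E.range_eq ▸ ⟨_, rfl⟩)
  obtain ⟨w, hw, hwv⟩ := hv
  rw [E.injective hwv] at hw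
  exact hw

theorem isNoetherianRing [Group.FG H] (E : IsDerivedExtension ι π) :
    IsNoetherianRing (MonoidAlgebra ℤ Q) := by
  have : Group.FG Q := Group.fg_of_surjective E.surjective
  have : Monoid.FG Q := inferInstance
  exact Algebra.FiniteType.isNoetherianRing ℤ (MonoidAlgebra ℤ Q)

/-- If the commutator subgroup is finitely generated abelian, then `H` is polycyclic. -/
theorem polycyclic [Group.FG H] (E : IsDerivedExtension ι π) (hV : Module.Finite ℤ V) :
    Polycyclic H := by
  have : Group.FG Q := Group.fg_of_surjective E.surjective
  have : AddGroup.FG V := Module.Finite.iff_addGroup_fg.mp hV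
  have : Group.FG (Multiplicative V) := inferInstance
  refine ⟨Group.isSolvable_of_ker_le_range ι π (E.ker_eq.trans E.range_eq.symm).le, fun L => ?_⟩
  rw [Group.fg_iff_subgroup_fg]
  refine Subgroup.fg_of_fg_map_of_fg_inf_ker π L (Subgroup.fg_of_commGroup _) ?_
  rw [E.ker_eq, ← E.range_eq, inf_comm, ← Subgroup.map_comap_eq]
  exact (Subgroup.fg_of_commGroup _).map_monoidHom ι

/-- If `Q` has finite image in the residue field at each point of the support of `V`, then `H` is
virtually nilpotent. -/
theorem virtuallyNilpotent [Group.FG H] (E : IsDerivedExtension ι π)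
    (h : ∀ p ∈ Module.support (MonoidAlgebra ℤ Q) V,
      (Set.range fun q => algebraMap _ p.asIdeal.ResidueField (MonoidAlgebra.of ℤ Q q)).Finite) :
    VirtuallyNilpotent H := by
  have := E.finite
  have := E.isNoetherianRing
  let R := MonoidAlgebra ℤ Q
  let a := Module.annihilator R V
  have hmin := a.finite_minimalPrimes_of_isNoetherianRing R
  have hprime : ∀ p : a.minimalPrimes, p.1.IsPrime := fun p => p.2.1.1
  let χ (p : a.minimalPrimes) : Q →* p.1.ResidueField :=
    (algebraMap R p.1.ResidueField : R →* p.1.ResidueField).comp (MonoidAlgebra.of ℤ Q)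
  have hχ : ∀ p : a.minimalPrimes, (χ p).toHomUnits.ker.FiniteIndex := by
    intro p
    have hp := h ⟨p.1, hprime p⟩ (by
      rw [Module.support_eq_zeroLocus]
      exact p.2.1.2)
    refine ⟨?_⟩
    rw [Subgroup.index_ker]
    have : Finite (χ p).toHomUnits.range := by
      refine Set.Finite.to_subtype (Set.Finite.of_finite_image (f := Units.val) ?_
        Units.val_injective.injOn)
      refine hp.subset ?_
      rintro _ ⟨_, ⟨q, rfl⟩, rfl⟩
      exact ⟨q, rfl⟩
    exact Nat.card_pos.ne'
  have : Finite a.minimalPrimes := hmin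
  let Q₀ : Subgroup Q := ⨅ p, (χ p).toHomUnits.ker
  have hQ₀ : Q₀.FiniteIndex := Subgroup.finiteIndex_iInf hχ
  let J : Ideal R := Ideal.span ((fun q => MonoidAlgebra.of ℤ Q q - 1) '' Q₀)
  have hJ : J ≤ a.radical := by
    rw [← Ideal.sInf_minimalPrimes, Ideal.span_le]
    rintro _ ⟨q, hq, rfl⟩
    rw [SetLike.mem_coe, Submodule.mem_sInf]
    intro p hp
    have := hprime ⟨p, hp⟩
    have h1 := congrArg Units.val ((Subgroup.mem_iInf.mp hq) ⟨p, hp⟩)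
    rw [← Ideal.algebraMap_residueField_eq_zero (I := p), map_sub, map_one, sub_eq_zero]
    exact h1
  obtain ⟨n, hn⟩ := Ideal.exists_radical_pow_le_of_fg a (IsNoetherian.noetherian _)
  have hJn : J ^ n • (⊤ : Submodule R V) = ⊥ := by
    rw [eq_bot_iff, Submodule.smul_le]
    intro r hr v _
    exact (Submodule.mem_bot R).mpr
      (Module.mem_annihilator.mp (hn (Ideal.pow_right_mono hJ n hr)) v)
  have hfi : (Q₀.comap π).FiniteIndex :=
    ⟨by rw [Subgroup.index_comap_of_surjective _ E.surjective]; exact hQ₀.index_ne_zero⟩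
  refine ⟨Q₀.comap π, hfi, ?_⟩
  rw [Subgroup.nilpotent_iff_finite_descending_central_series]
  let D : ℕ → Subgroup H := fun k => Nat.casesOn k ⊤ fun k =>
    (J ^ k • (⊤ : Submodule R V)).toAddSubgroup.toSubgroup.map ι
  refine ⟨n + 1, fun k => (D k).subgroupOf _, ⟨rfl, fun x k hx g => ?_⟩, ?_⟩
  · cases k with
    | zero =>
      obtain ⟨v, hv⟩ := E.commutator_mem_range x.1 g.1
      refine Subgroup.mem_subgroupOf.mpr ⟨v, ?_, hv⟩
      change v.toAdd ∈ J ^ 0 • (⊤ : Submodule R V)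
      simp
    | succ k =>
      obtain ⟨v, hv, hvx⟩ := Subgroup.mem_subgroupOf.mp hx
      refine Subgroup.mem_subgroupOf.mpr
        ⟨.ofAdd (-((MonoidAlgebra.of ℤ Q (π g) - 1) • v.toAdd)), ?_, ?_⟩
      · change -((MonoidAlgebra.of ℤ Q (π g) - 1) • v.toAdd) ∈ J ^ (k + 1) • (⊤ : Submodule R V)
        rw [pow_succ', Submodule.mul_smul]
        exact neg_mem (Submodule.smul_mem_smul (Ideal.subset_span ⟨_, g.2, rfl⟩) hv)
      · rw [sub_smul, one_smul, neg_sub, sub_eq_add_neg, ofAdd_add, ofAdd_neg, map_mul, map_inv,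
          E.conj, ofAdd_toAdd, hvx]
        simp [commutatorElement_def, mul_assoc]
  · change (D (n + 1)).subgroupOf _ = ⊥
    have : D (n + 1) = ⊥ := by
      change (J ^ n • (⊤ : Submodule R V)).toAddSubgroup.toSubgroup.map ι = ⊥
      rw [hJn]
      ext; simp
    rw [this, Subgroup.bot_subgroupOf]

theorem π_ι (E : IsDerivedExtension ι π) (v : Multiplicative V) : π (ι v) = 1 := by
  rw [← MonoidHom.mem_ker, E.ker_eq, ← E.range_eq]
  exact ⟨v, rfl⟩

/-- A point `p` of the support of `V` whose residue field contains an infinite image of `Q` gives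
an affine representation over this residue field whose image is not virtually nilpotent, and not
polycyclic unless `ℤ[Q] ⧸ p` is finitely generated as an abelian group. -/
theorem exists_affine_of_infinite [Group.FG H] (E : IsDerivedExtension ι π)
    (p : PrimeSpectrum (MonoidAlgebra ℤ Q)) (hp : p ∈ Module.support (MonoidAlgebra ℤ Q) V)
    (hinf : (Set.range fun q =>
      algebraMap _ p.asIdeal.ResidueField (MonoidAlgebra.of ℤ Q q)).Infinite) :
    ∃ ρ : H →* Aff p.asIdeal.ResidueField, ¬ VirtuallyNilpotent ρ.range ∧
      (Polycyclic ρ.range → Module.Finite ℤ (MonoidAlgebra ℤ Q ⧸ p.asIdeal)) := by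
  have := E.finite
  obtain ⟨f, hf⟩ := exists_ne_zero_linearMap_residueField p hp
  let R := MonoidAlgebra ℤ Q
  let χ : Q →* p.asIdeal.ResidueFieldˣ :=
    ((algebraMap R p.asIdeal.ResidueField : R →* p.asIdeal.ResidueField).comp
      (MonoidAlgebra.of ℤ Q)).toHomUnits
  have hχ : ∀ q, (χ q : p.asIdeal.ResidueField) = algebraMap R _ (MonoidAlgebra.of ℤ Q q) :=
    fun q => rfl
  have hχinf : Infinite (χ.comp π).range := by
    have h1 : (Set.range χ).Infinite := by
      refine Set.Infinite.of_image Units.val ?_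
      rw [← Set.range_comp]
      exact hinf
    rw [MonoidHom.range_comp, MonoidHom.range_eq_top.mpr E.surjective, ← MonoidHom.range_eq_map]
    exact h1.to_subtype
  obtain ⟨h₀, hh₀⟩ : ∃ h₀, χ.comp π h₀ ≠ 1 := by
    by_contra! h
    have : (χ.comp π).range = ⊥ := by
      rw [eq_bot_iff]
      rintro _ ⟨x, rfl⟩
      exact h x
    rw [this] at hχinf
    exact not_finite (⊥ : Subgroup p.asIdeal.ResidueFieldˣ)
  obtain ⟨ρ, hρa, hρb⟩ := Aff.exists_monoidHom ι E.range_eq.ge (χ.comp π) f.toAddMonoidHom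
    (fun h v w hw => by
      rw [← E.conj] at hw
      obtain rfl : w = MonoidAlgebra.of ℤ Q (π h) • v := E.injective hw
      change f (_ • v) = _
      rw [map_smul, Algebra.smul_def]
      rfl) hh₀
  have hρι : ∀ v, (ρ (ι v)).a = 1 := fun v => by
    rw [hρa, MonoidHom.comp_apply, E.π_ι, map_one]
  refine ⟨ρ, ?_, fun h => ?_⟩
  · obtain ⟨v, hv⟩ := DFunLike.ne_iff.mp hf
    refine Aff.not_virtuallyNilpotent_s7 (t := ρ (ι (.ofAdd v))) ⟨_, rfl⟩ (hρι _) ?_ ?_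
    · rw [hρb]
      exact hv
    · have : ρ.range.map Aff.proj = (χ.comp π).range := by
        rw [← MonoidHom.range_comp]
        congr 1
        ext1 h
        exact hρa h
      rwa [this]
  · refine Module.finite_int_quotient_of_range p.asIdeal f hf ?_
    exact Module.Finite.iff_addGroup_fg.mpr
      (Aff.fg_range_of_polycyclic ι f.toAddMonoidHom ρ hρι hρb h)

theorem exists_affine {H V : Type*} {Q : Type} [Group H] [CommGroup Q] [AddCommGroup V]
    [Module (MonoidAlgebra ℤ Q) V] {ι : Multiplicative V →* H} {π : H →* Q} [Group.FG H]
    (E : IsDerivedExtension ι π) :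
    ∃ (K : Type) (inst : Field K),
      letI := inst
      ∃ ρ : H →* Aff K,
        (¬ VirtuallyNilpotent H → ¬ VirtuallyNilpotent ρ.range) ∧
        (¬ Polycyclic H → ¬ Polycyclic ρ.range) := by
  have := E.finite
  have := E.isNoetherianRing
  by_cases hP : Polycyclic H
  · by_cases hN : VirtuallyNilpotent H
    · exact ⟨ℚ, inferInstance, 1, absurd hN, absurd hP⟩
    · obtain ⟨p, hp, hinf⟩ : ∃ p ∈ Module.support (MonoidAlgebra ℤ Q) V, (Set.range fun q =>
          algebraMap _ p.asIdeal.ResidueField (MonoidAlgebra.of ℤ Q q)).Infinite := by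
        by_contra! h
        exact hN (E.virtuallyNilpotent h)
      obtain ⟨ρ, hρ, -⟩ := E.exists_affine_of_infinite p hp hinf
      exact ⟨_, inferInstance, ρ, fun _ => hρ, absurd hP⟩
  · obtain ⟨p, hp, hfin⟩ : ∃ p ∈ Module.support (MonoidAlgebra ℤ Q) V,
        ¬ Module.Finite ℤ (MonoidAlgebra ℤ Q ⧸ p.asIdeal) := by
      by_contra! h
      exact hP (E.polycyclic (Module.finite_int_of_forall_mem_support h))
    obtain ⟨ρ, hρ, hρ'⟩ := E.exists_affine_of_infinite p hp
      fun h => hfin (MonoidAlgebra.finite_int_quotient p.asIdeal h)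
    exact ⟨_, inferInstance, ρ, fun _ => hρ, fun _ h => hfin (hρ' h)⟩

end IsDerivedExtension

theorem MonoidHom.exists_lift_of_ker_le {H Q M : Type*} [Group H] [Group Q] [Monoid M]
    (π : H →* Q) (hπ : Function.Surjective π) (C : H →* M) (hC : π.ker ≤ C.ker) :
    ∃ s : Q →* M, ∀ h, s (π h) = C h :=
  ⟨(QuotientGroup.lift π.ker C hC).comp
    (QuotientGroup.quotientKerEquivOfSurjective π hπ).symm.toMonoidHom, fun h => by
      have : (QuotientGroup.quotientKerEquivOfSurjective π hπ).symm (π h) = (h : H ⧸ π.ker) :=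
        (MulEquiv.symm_apply_eq _).mpr rfl
      simp [this]⟩

theorem exists_module_monoidAlgebra {Q V : Type*} [Monoid Q] [AddCommGroup V]
    (s : Q →* Module.End ℤ V) :
    ∃ _ : Module (MonoidAlgebra ℤ Q) V, ∀ q v, MonoidAlgebra.of ℤ Q q • v = s q v := by
  obtain ⟨φ, hφ⟩ : ∃ φ : MonoidAlgebra ℤ Q →+* Module.End ℤ V,
      ∀ q, φ (MonoidAlgebra.of ℤ Q q) = s q :=
    ⟨(MonoidAlgebra.lift ℤ (Module.End ℤ V) Q s).toRingHom, MonoidAlgebra.lift_of s⟩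
  exact ⟨Module.compHom V φ, fun q v => LinearMap.congr_fun (hφ q) v⟩

/-- If the commutator subgroup of `H` is the image of an injective homomorphism from an abelian
group, then the latter is a module over the group ring of the abelianization of `H`. -/
theorem exists_isDerivedExtension {H V Q : Type*} [Group H] [CommGroup Q] [AddCommGroup V]
    (ι : Multiplicative V →* H) (hι : Function.Injective ι) (hrange : ι.range = commutator H)
    (π : H →* Q) (hπ : Function.Surjective π) (hker : π.ker = commutator H) :
    ∃ _ : Module (MonoidAlgebra ℤ Q) V, IsDerivedExtension ι π := by
  obtain ⟨j, hj⟩ : ∃ j : V → H, ∀ v, j v = ι (.ofAdd v) := ⟨_, fun _ => rfl⟩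
  have hinj : Function.Injective j := fun v w h => hι (by rwa [hj, hj] at h)
  have hjadd : ∀ v w, j (v + w) = j v * j w := fun v w => by rw [hj, hj, hj, ofAdd_add, map_mul]
  have hact : ∀ h v, ∃ w : V, j w = h * j v * h⁻¹ := fun h v => by
    have : ι.range.Normal := hrange ▸ inferInstance
    obtain ⟨w, hw⟩ := this.conj_mem _ ⟨.ofAdd v, rfl⟩ h
    exact ⟨w.toAdd, by rw [hj, hj, ← hw, ofAdd_toAdd]⟩
  choose c hc using hact
  have hadd : ∀ h v w, c h (v + w) = c h v + c h w := fun h v w => hinj <| by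
    simp [hc, hjadd]
  have hone : ∀ v, c 1 v = v := fun v => hinj <| by simp [hc]
  have hmul : ∀ g h v, c (g * h) v = c g (c h v) := fun g h v => hinj <| by simp [hc, mul_assoc]
  have htriv : ∀ g ∈ π.ker, ∀ v, c g v = v := fun g hg v => hinj <| by
    rw [hker, ← hrange] at hg
    obtain ⟨w, rfl⟩ := hg
    rw [hc, hj, ← map_mul, mul_comm, map_mul, mul_assoc, mul_inv_cancel, mul_one]
  obtain ⟨C, hC⟩ : ∃ C : H →* Module.End ℤ V, ∀ h v, C h v = c h v :=
    ⟨{ toFun := fun h => (AddMonoidHom.mk' (c h) (hadd h)).toIntLinearMap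
       map_one' := LinearMap.ext hone
       map_mul' := fun g h => LinearMap.ext (hmul g h) }, fun _ _ => rfl⟩
  have hker' : π.ker ≤ C.ker := fun g hg => LinearMap.ext fun v => by
    rw [hC, htriv g hg, Module.End.one_apply]
  obtain ⟨s, hs⟩ := π.exists_lift_of_ker_le hπ C hker'
  obtain ⟨inst, hinst⟩ := exists_module_monoidAlgebra s
  refine ⟨inst, hι, hrange, hker, hπ, fun h v => ?_⟩
  rw [hinst, hs, hC, ← hj, ← hj]
  exact hc h v

/-- Every finitely generated metabelian group `H` admits a homomorphism to the
affine group of a `K`-line whose image is not virtually nilpotent (resp. not polycyclic) whenever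
`H` is not. -/
theorem stmt_7 (H : Type*) [Group H] [Group.FG H] (hmeta : Metabelian H) :
    ∃ (K : Type) (inst : Field K),
      letI := inst
      ∃ ρ : H →* Aff K,
        (¬ VirtuallyNilpotent H → ¬ VirtuallyNilpotent ρ.range) ∧
        (¬ Polycyclic H → ¬ Polycyclic ρ.range) := by
  let inst : CommGroup (commutator H) :=
    { (inferInstance : Group (commutator H)) with mul_comm := hmeta }
  have hcount : Countable H := by
    obtain ⟨S, _, φ, hφ⟩ := Group.fg_iff_exists_freeGroup_hom_surjective_finite.mp ‹Group.FG H›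
    exact hφ.countable
  have : Countable (Abelianization H) := QuotientGroup.mk_surjective.countable
  let e : Abelianization H ≃* Shrink.{0} (Abelianization H) := Shrink.mulEquiv.symm
  let ι := (commutator H).subtype.comp
    (MulEquiv.multiplicativeAdditive (commutator H)).toMonoidHom
  have hι : Function.Injective ι := (commutator H).subtype_injective.comp
    (MulEquiv.multiplicativeAdditive (commutator H)).injective
  have hrange : ι.range = commutator H := by
    rw [MonoidHom.range_comp, MonoidHom.range_eq_top.mpr (MulEquiv.surjective _),
      ← MonoidHom.range_eq_map, Subgroup.range_subtype]
  have hker : (e.toMonoidHom.comp Abelianization.of).ker = commutator H := by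
    rw [← Abelianization.ker_of]
    exact MonoidHom.ker_mulEquiv_comp _ e
  obtain ⟨_, E⟩ := exists_isDerivedExtension ι hι hrange (e.toMonoidHom.comp Abelianization.of)
    (e.surjective.comp QuotientGroup.mk_surjective) hker
  exact E.exists_affine
end

section
/- Let K be a field equipped with a nonarchimedean absolute value v (so v(a + b) ≤ max(v(a), v(b)) for all a, b ∈ K). Let p, q, α, β ∈ K with p ≠ q, α ≠ 0, β ≠ 0, v(α) < 1 and v(β) < 1. Let x and y be the elements of the affine group K ⋊ Kˣ corresponding to the maps z ↦ α(z − p) + p and z ↦ β(z − q) + q. Then x and y are positively independent. -/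
open Pointwise

/-- If no nonempty product of the `f i` is trivial and every product determines its first factor,
then the `f i` freely generate a free submonoid. -/
theorem FreeMonoid.lift_injective_of_head_eq {ι M : Type*} [LeftCancelMonoid M] (f : ι → M)
    (hone : ∀ i (l : List ι), f i * (l.map f).prod ≠ 1)
    (hhead : ∀ i j (l m : List ι), f i * (l.map f).prod = f j * (m.map f).prod → i = j) :
    Function.Injective (FreeMonoid.lift f) := by
  have key : ∀ l m : List ι, (l.map f).prod = (m.map f).prod → l = m := by
    intro l
    induction l with
    | nil =>
      rintro (_ | ⟨j, m⟩) h
      · rfl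
      · exact absurd (by simpa using h.symm) (hone j m)
    | cons i l ih =>
      rintro (_ | ⟨j, m⟩) h
      · exact absurd (by simpa using h) (hone i l)
      · simp only [List.map_cons, List.prod_cons] at h
        obtain rfl := hhead i j l m h
        rw [ih m (mul_left_cancel h)]
  intro a b h
  rw [FreeMonoid.lift_apply, FreeMonoid.lift_apply] at h
  exact FreeMonoid.toList.injective (key _ _ h)

namespace Aff

variable {K : Type*} [Field K]

/-- The image of `z` under the affine map `f`. -/
def eval (f : Aff K) (z : K) : K := (f.a : K) * z + f.b

theorem eval_mul (f g : Aff K) (z : K) : (f * g).eval z = f.eval (g.eval z) := by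
  simp only [eval, mul_a, mul_b, Units.val_mul]
  ring

theorem eval_homothety_sub (c : Kˣ) (s z : K) :
    (⟨c, s - c * s⟩ : Aff K).eval z - s = c * (z - s) := by
  simp only [eval]
  ring

variable {v : AbsoluteValue K ℝ}

/-- A contracting homothety maps a closed ball around its center into the open ball. -/
theorem map_eval_homothety_sub_lt {c : Kˣ} {s z : K} {r : ℝ} (hc : v c < 1) (hr : 0 < r)
    (hz : v (z - s) ≤ r) : v ((⟨c, s - c * s⟩ : Aff K).eval z - s) < r := by
  rw [eval_homothety_sub, map_mul]
  nlinarith [v.nonneg (c : K), v.nonneg (z - s)]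

theorem map_a_list_prod_le_one {ι : Type*} {f : ι → Aff K} (hf : ∀ i, v (f i).a < 1)
    (l : List ι) : v ((l.map f).prod.a : K) ≤ 1 := by
  induction l with
  | nil => simp
  | cons i l ih =>
    simp only [List.map_cons, List.prod_cons, mul_a, Units.val_mul, map_mul]
    exact mul_le_one₀ (hf i).le (v.nonneg _) ih

theorem mul_list_prod_ne_one {ι : Type*} {f : ι → Aff K} (hf : ∀ i, v (f i).a < 1)
    (i : ι) (l : List ι) : f i * (l.map f).prod ≠ 1 := by
  intro h
  have h1 := congrArg (fun g : Aff K => v (g.a : K)) h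
  simp only [mul_a, Units.val_mul, map_mul, one_a, Units.val_one, map_one] at h1
  nlinarith [hf i, map_a_list_prod_le_one hf l, v.nonneg ((f i).a : K)]

end Aff

/-- (Non-archimedean ping-pong.) Over a field with a nonarchimedean absolute
value, two homotheties with distinct fixed points `p ≠ q` and contracting ratios are positively
independent. -/
theorem stmt_9 (K : Type*) [Field K] (v : AbsoluteValue K ℝ)
    (hna : ∀ a b : K, v (a + b) ≤ max (v a) (v b))
    (p q α β : K) (hpq : p ≠ q) (hα : α ≠ 0) (hβ : β ≠ 0)
    (hαlt : v α < 1) (hβlt : v β < 1) :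
    PosIndep (⟨Units.mk0 α hα, p - α * p⟩ : Aff K) (⟨Units.mk0 β hβ, q - β * q⟩ : Aff K) := by
  set f : Bool → Aff K := fun b =>
    if b then ⟨Units.mk0 α hα, p - α * p⟩ else ⟨Units.mk0 β hβ, q - β * q⟩
  set r := v (p - q)
  have hr0 : 0 < r := v.pos (sub_ne_zero.mpr hpq)
  have hqp : v (q - p) = r := v.map_sub q p
  have to_q : ∀ {z}, v (z - p) ≤ r → v (z - q) ≤ r := fun {z} hz => by
    simpa using (hna (z - p) (p - q)).trans (max_le hz le_rfl)
  have to_p : ∀ {z}, v (z - q) ≤ r → v (z - p) ≤ r := fun {z} hz => by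
    simpa using (hna (z - q) (q - p)).trans (max_le hz hqp.le)
  have htrue : ∀ {z}, v (z - p) ≤ r → v ((f true).eval z - p) < r := fun hz =>
    Aff.map_eval_homothety_sub_lt (c := Units.mk0 α hα) hαlt hr0 hz
  have hfalse : ∀ {z}, v (z - p) ≤ r → v ((f false).eval z - q) < r := fun hz =>
    Aff.map_eval_homothety_sub_lt (c := Units.mk0 β hβ) hβlt hr0 (to_q hz)
  have hball : ∀ l : List Bool, v ((l.map f).prod.eval p - p) ≤ r := by
    intro l
    induction l with
    | nil => simpa [Aff.eval] using hr0.le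
    | cons b l ih =>
      rw [List.map_cons, List.prod_cons, Aff.eval_mul]
      cases b
      · exact to_p (hfalse ih).le
      · exact (htrue ih).le
  have hdisj : ∀ l m : List Bool, f true * (l.map f).prod ≠ f false * (m.map f).prod := by
    intro l m h
    have h1 := htrue (hball l)
    have h2 := hfalse (hball m)
    rw [← Aff.eval_mul, h, v.map_sub] at h1
    rw [← Aff.eval_mul] at h2
    have h3 := (hna _ _).trans_lt (max_lt h1 h2)
    rw [sub_add_sub_cancel] at h3
    exact h3.ne rfl
  have hcontr : ∀ b, v ((f b).a : K) < 1 := by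
    rintro (_ | _)
    exacts [hβlt, hαlt]
  refine FreeMonoid.lift_injective_of_head_eq f (Aff.mul_list_prod_ne_one hcontr) ?_
  rintro (_ | _) (_ | _) l m h
  exacts [rfl, absurd h.symm (hdisj m l), absurd h (hdisj l m), rfl]
end

section
/- Let K be a finitely generated field (finitely generated as a field over its prime subfield) and let α be a nonzero element of K such that α⁻¹ is not integral over the prime subring of K (the image of ℤ in K). Then there exists a nonarchimedean absolute value v on K with v(α) < 1. -/
open Pointwise

/-- A nontrivial valuation with archimedean value group yields a nonarchimedean absolute value with
the same open unit ball. -/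
theorem Valuation.exists_absoluteValue_of_mulArchimedean {K Γ₀ : Type*} [Field K]
    [LinearOrderedCommGroupWithZero Γ₀] [MulArchimedean Γ₀] (v : Valuation K Γ₀)
    [v.IsNontrivial] :
    ∃ w : AbsoluteValue K ℝ, (∀ a b, w (a + b) ≤ max (w a) (w b)) ∧
      ∀ x, w x < 1 ↔ v x < 1 := by
  have : MulArchimedean (MonoidWithZeroHom.ValueGroup₀ (.ofClass v)) :=
    MulArchimedean.comap MonoidWithZeroHom.ValueGroup₀.embedding.toMonoidHom
      MonoidWithZeroHom.ValueGroup₀.embedding_strictMono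
  obtain ⟨hv⟩ := v.nonempty_rankOne_iff_mulArchimedean.mpr this
  have hmono := RankOne.strictMono v
  have hadd (a b : K) : (RankOne.hom v (v.restrict (a + b)) : ℝ) ≤
      max (RankOne.hom v (v.restrict a) : ℝ) (RankOne.hom v (v.restrict b)) := by
    rw [← NNReal.coe_max, NNReal.coe_le_coe, ← hmono.monotone.map_max]
    exact hmono.monotone (v.restrict.map_add a b)
  refine ⟨{ toFun x := RankOne.hom v (v.restrict x)
            map_mul' x y := by simp
            nonneg' x := NNReal.coe_nonneg _
            eq_zero' x := by simp
            add_le' x y := (hadd x y).trans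
              (max_le_add_of_nonneg (NNReal.coe_nonneg _) (NNReal.coe_nonneg _)) },
    hadd, fun x ↦ ?_⟩
  change (RankOne.hom v (v.restrict x) : ℝ) < 1 ↔ _
  rw [← NNReal.coe_one, NNReal.coe_lt_coe, ← map_one (RankOne.hom v), hmono.lt_iff_lt,
    v.restrict_lt_one_iff]

/-- The valuation ring of all `x` with `α * x ^ n ∈ V` for every `n`. When `α` has valuation less
than one, this is the localization of `V` at the radical of `(α)`. -/
def ValuationSubring.localizationRadical {K : Type*} [Field K] (V : ValuationSubring K) (α : K)
    (hα : V.valuation α ≤ 1) : ValuationSubring K where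
  carrier := {x | ∀ n : ℕ, V.valuation α * V.valuation x ^ n ≤ 1}
  mul_mem' {x y} hx hy n := by
    rw [map_mul]
    rcases le_total (V.valuation x) (V.valuation y) with h | h
    · refine le_trans ?_ (hy (n + n))
      rw [mul_pow, pow_add]
      gcongr
    · refine le_trans ?_ (hx (n + n))
      rw [mul_pow, pow_add]
      gcongr
  one_mem' n := by simpa only [map_one, one_pow, mul_one]
  add_mem' {x y} hx hy n := by
    rcases le_max_iff.mp (V.valuation.map_add x y) with h | h
    · exact le_trans (by gcongr) (hx n)
    · exact le_trans (by gcongr) (hy n)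
  zero_mem' n := by
    rcases n.eq_zero_or_pos with rfl | hn
    · simpa only [pow_zero, mul_one]
    · simp [hn.ne']
  neg_mem' {x} hx n := by simpa using hx n
  mem_or_inv_mem' x := by
    rcases V.mem_or_inv_mem x with h | h
    · exact .inl fun n ↦ mul_le_one' hα (pow_le_one' ((V.valuation_le_one_iff x).mpr h) n)
    · exact .inr fun n ↦ mul_le_one' hα (pow_le_one' ((V.valuation_le_one_iff _).mpr h) n)

/-- If every element of `K` is bounded by a power of `α⁻¹` in a valuation whose maximal ideal
contains `α`, then some nonarchimedean absolute value on `K` is less than one at `α`. -/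
theorem ValuationSubring.exists_absoluteValue_of_le_inv_pow {K : Type*} [Field K]
    (V : ValuationSubring K) {α : K} (hα₀ : α ≠ 0) (hα : V.valuation α < 1)
    (hpow : ∀ x, ∃ n : ℕ, V.valuation x ≤ (V.valuation α)⁻¹ ^ n) :
    ∃ w : AbsoluteValue K ℝ, (∀ a b, w (a + b) ≤ max (w a) (w b)) ∧ w α < 1 := by
  have hv₀ : 0 < V.valuation α := by simpa [zero_lt_iff] using hα₀
  let W := V.localizationRadical α hα.le
  have hVW : V ≤ W := fun x hx n ↦
    mul_le_one' hα.le (pow_le_one' ((V.valuation_le_one_iff x).mpr hx) n)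
  have hαW : W.valuation α < 1 := by
    have h : α⁻¹ ∉ W := fun h ↦ by
      have := h 2
      rw [map_inv₀, pow_two, mul_inv_cancel_left₀ hv₀.ne', inv_le_one₀ hv₀] at this
      exact this.not_gt hα
    rw [← W.valuation_le_one_iff, map_inv₀, inv_le_one₀ (by simpa [zero_lt_iff] using hα₀)] at h
    exact not_le.mp h
  have : W.valuation.IsNontrivial := ⟨α, by simpa using hα₀, hαW.ne⟩
  have : MulArchimedean W.ValueGroup := ⟨fun γ δ hδ ↦ by
    obtain ⟨x, rfl⟩ := W.valuation_surjective γ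
    obtain ⟨y, rfl⟩ := W.valuation_surjective δ
    have hy : y ∉ W := fun h ↦ hδ.not_ge ((W.valuation_le_one_iff y).mpr h)
    have hy₀ : y ≠ 0 := fun h ↦ hy (h ▸ W.zero_mem)
    have hVy (k : ℕ) : 0 < V.valuation y ^ k := by simp [zero_lt_iff, hy₀]
    have hWy (k : ℕ) : 0 < W.valuation y ^ k := by simp [zero_lt_iff, hy₀]
    obtain ⟨n, hn⟩ : ∃ n : ℕ, 1 < V.valuation α * V.valuation y ^ n := by
      by_contra! h
      exact hy h
    obtain ⟨m, hm⟩ := hpow x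
    refine ⟨n * m, ?_⟩
    have hxy : x / y ^ (n * m) ∈ W := hVW <| by
      rw [← V.valuation_le_one_iff, map_div₀, map_pow,
        div_le_one₀ (hVy _), pow_mul]
      refine hm.trans ?_
      gcongr
      rw [inv_le_iff_one_le_mul₀' hv₀]
      exact hn.le
    rwa [← W.valuation_le_one_iff, map_div₀, map_pow,
      div_le_one₀ (hWy _)] at hxy⟩
  obtain ⟨w, hw, hw₁⟩ := W.valuation.exists_absoluteValue_of_mulArchimedean
  exact ⟨w, hw, (hw₁ α).mpr hαW⟩

open IsLocalRing in
/-- Every prime of a subring of a field is the center of a valuation ring. -/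
theorem Ideal.IsPrime.exists_valuationSubring {K : Type*} [Field K] {A : Subring K} (P : Ideal A)
    [P.IsPrime] :
    ∃ V : ValuationSubring K, ∀ a : A, V.valuation a ≤ 1 ∧ (V.valuation a < 1 ↔ a ∈ P) := by
  obtain ⟨V, hle, hloc⟩ := (LocalSubring.ofPrime A P).exists_le_valuationSubring
  refine ⟨V, fun a ↦ ?_⟩
  have ha : algebraMap A (LocalSubring.ofPrime A P).toSubring a ∈ maximalIdeal _ ↔ a ∈ P :=
    IsLocalization.AtPrime.to_map_mem_maximal_iff _ P a
  have hV : (a : K) ∈ V := hle (LocalSubring.le_ofPrime A P a.2)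
  refine ⟨(V.valuation_le_one_iff a).mpr hV, ?_⟩
  rw [← ha, mem_maximalIdeal, mem_nonunits_iff, ← isUnit_map_iff (Subring.inclusion hle)]
  exact (V.valuation_lt_one_iff ⟨a, hV⟩).symm

/-- If `P` is minimal over `(α)` in a noetherian domain, then every nonzero `b` divides
`α ^ n * s` for some `n` and some `s` outside `P`. -/
theorem Ideal.exists_dvd_pow_mul_of_mem_minimalPrimes {A : Type*} [CommRing A] [IsDomain A]
    [IsNoetherianRing A] {α b : A} {P : Ideal A} (hP : P ∈ (Ideal.span {α}).minimalPrimes)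
    (hb : b ≠ 0) : ∃ n : ℕ, ∃ s ∉ P, b ∣ α ^ n * s := by
  have := hP.isPrime
  by_contra! h
  obtain ⟨Q, hQ, hbQ, hdisj⟩ := Ideal.exists_le_prime_disjoint (Ideal.span {b})
    (Submonoid.powers α ⊔ P.primeCompl) <| by
      rw [Set.disjoint_left]
      intro x hx hxS
      obtain ⟨_, ⟨n, rfl⟩, s, hs, rfl⟩ := Submonoid.mem_sup.mp hxS
      exact h n s hs (Ideal.mem_span_singleton.mp hx)
  have hαQ : α ∉ Q := fun hα ↦ Set.disjoint_left.mp hdisj hα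
    (Submonoid.mem_sup_left (Submonoid.mem_powers α))
  have hQP : Q < P := by
    refine lt_of_le_of_ne (fun x hx ↦ ?_) fun h ↦ hαQ (h ▸ hP.1.2 (Ideal.mem_span_singleton_self α))
    by_contra hxP
    exact Set.disjoint_left.mp hdisj hx (Submonoid.mem_sup_right hxP)
  have hQ₀ : ⊥ < Q := bot_lt_iff_ne_bot.mpr fun h ↦ hb <| by
    simpa [h] using hbQ (Ideal.mem_span_singleton_self b)
  have h₁ := Ideal.height_add_one_le_of_lt_of_isPrime hQ₀
  have h₂ := Ideal.height_add_one_le_of_lt_of_isPrime hQP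
  have h₃ := Ideal.height_le_one_of_isPrincipal_of_mem_minimalPrimes _ P hP
  rw [Ideal.height_bot, zero_add] at h₁
  have : (1 : ℕ∞) + 1 ≤ 1 := (by gcongr : (1 : ℕ∞) + 1 ≤ Q.height + 1).trans (h₂.trans h₃)
  exact absurd this (by decide)

/-- If `α⁻¹` is not integral over `ℤ`, then a finitely generated field has a finite generating set
containing `α` such that `α` is not invertible in the subring it generates. -/
theorem exists_finite_inv_notMem_subringClosure {K : Type*} [Field K]
    (hfg : ∃ S : Finset K, Subfield.closure (S : Set K) = ⊤) {α : K}
    (hint : ¬ IsIntegral ℤ α⁻¹) :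
    ∃ T : Set K, T.Finite ∧ Subfield.closure T = ⊤ ∧ α ∈ T ∧ α⁻¹ ∉ Subring.closure T := by
  classical
  obtain ⟨S, hS⟩ := hfg
  let R : Subring K := (integralClosure ℤ K).toSubring
  have : IsIntegrallyClosedIn R K := inferInstanceAs (IsIntegrallyClosedIn (integralClosure ℤ K) K)
  obtain ⟨V, -, hV⟩ := Subring.exists_le_valuationSubring_of_isIntegrallyClosedIn
    (R := R) (x := α⁻¹) hint
  have hαV : α ∈ V := (V.mem_or_inv_mem α).resolve_right hV
  let g : K → K := fun x ↦ if x ∈ V then x else x⁻¹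
  have hg (x : K) : g x ∈ V := by
    by_cases h : x ∈ V
    · simp [g, h]
    · simpa [g, h] using (V.mem_or_inv_mem x).resolve_left h
  refine ⟨insert α (g '' S), (S.finite_toSet.image g).insert α, ?_, Set.mem_insert .., fun h ↦ hV ?_⟩
  · refine top_unique (hS ▸ Subfield.closure_le.mpr fun x hx ↦ ?_)
    have hgx : g x ∈ Subfield.closure (insert α (g '' (S : Set K))) :=
      Subfield.subset_closure (Set.mem_insert_of_mem _ ⟨x, hx, rfl⟩)
    by_cases h : x ∈ V
    · simpa [g, h] using hgx
    · simpa [g, h] using hgx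
  · refine (Subring.closure_le (t := V.toSubring)).mpr ?_ h
    rintro _ (rfl | ⟨x, -, rfl⟩)
    exacts [hαV, hg x]

/-- (Tits' lemma.) If `K` is a finitely generated field and `α⁻¹` is not an
algebraic integer, then there is a nonarchimedean absolute value `v` on `K` with `v α < 1`. -/
theorem stmt_10 (K : Type*) [Field K] (hfg : ∃ S : Finset K, Subfield.closure (S : Set K) = ⊤)
    (α : K) (hα : α ≠ 0) (hint : ¬ IsIntegral ℤ α⁻¹) :
    ∃ v : AbsoluteValue K ℝ, (∀ a b : K, v (a + b) ≤ max (v a) (v b)) ∧ v α < 1 := by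
  obtain ⟨T, hT, hTtop, hαT, hαinv⟩ := exists_finite_inv_notMem_subringClosure hfg hint
  have : IsNoetherianRing (Subring.closure T) := is_noetherian_subring_closure T hT
  let a : Subring.closure T := ⟨α, Subring.subset_closure hαT⟩
  have ha : Ideal.span {a} ≠ ⊤ := fun h ↦ hαinv <| by
    obtain ⟨b, hb⟩ := (Ideal.span_singleton_eq_top.mp h).exists_right_inv
    have hb' : α * b = 1 := congrArg Subtype.val hb
    rw [inv_eq_of_mul_eq_one_right hb']
    exact b.2
  obtain ⟨P, hP⟩ := Ideal.nonempty_minimalPrimes ha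
  have := hP.isPrime
  obtain ⟨V, hV⟩ := Ideal.IsPrime.exists_valuationSubring P
  have hαV : V.valuation α < 1 := (hV a).2.mpr (hP.1.2 (Ideal.mem_span_singleton_self a))
  have hα₀ : 0 < V.valuation α := by simpa [zero_lt_iff] using hα
  refine V.exists_absoluteValue_of_le_inv_pow hα hαV fun x ↦ ?_
  obtain ⟨y, hy, z, hz, rfl⟩ := Subfield.mem_closure_iff.mp (hTtop ▸ Subfield.mem_top x)
  rcases eq_or_ne z 0 with rfl | hz₀
  · exact ⟨0, by simp⟩
  obtain ⟨n, s, hs, c, hc⟩ := Ideal.exists_dvd_pow_mul_of_mem_minimalPrimes hP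
    (b := ⟨z, hz⟩) (by simpa [Subtype.ext_iff] using hz₀)
  have hs₁ : V.valuation s = 1 := le_antisymm (hV s).1 (not_lt.mp (mt (hV s).2.mp hs))
  have hc' : V.valuation α ^ n = V.valuation z * V.valuation c := by
    simpa [hs₁] using congrArg (fun t : Subring.closure T ↦ V.valuation (t : K)) hc
  have hz₁ : 0 < V.valuation z := by simpa [zero_lt_iff] using hz₀
  refine ⟨n, ?_⟩
  rw [map_div₀, inv_pow, div_le_iff₀ hz₁, ← div_eq_inv_mul, le_div_iff₀ (pow_pos hα₀ n), hc']
  calc V.valuation y * (V.valuation z * V.valuation c)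
      ≤ 1 * (V.valuation z * 1) := by
        gcongr
        exacts [(hV ⟨y, hy⟩).1, (hV c).1]
    _ = V.valuation z := by simp
end

section
/- Let Γ be a group generated by two elements x and y such that the subgroup M generated by the set {xⁿ y x⁻ⁿ : n ∈ ℤ} is not finitely generated. Then the elements x and y x y⁻¹ are positively independent. -/
open Pointwise

/-- The subgroup generated by the conjugates `xⁱ y x⁻ⁱ` with `a ≤ i ≤ b`. -/
def conjSpan {G : Type*} [Group G] (x y : G) (a b : ℤ) : Subgroup G :=
  Subgroup.closure ((fun i : ℤ => x ^ i * y * x ^ (-i)) '' Set.Icc a b)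

namespace conjSpan

variable {G : Type*} [Group G] {x y : G}

theorem conj_mem {a b i : ℤ} (ha : a ≤ i) (hb : i ≤ b) :
    x ^ i * y * x ^ (-i) ∈ conjSpan x y a b :=
  Subgroup.subset_closure ⟨i, ⟨ha, hb⟩, rfl⟩

theorem le_iff {a b : ℤ} {L : Subgroup G} :
    conjSpan x y a b ≤ L ↔ ∀ i, a ≤ i → i ≤ b → x ^ i * y * x ^ (-i) ∈ L := by
  simp only [conjSpan, Subgroup.closure_le, Set.image_subset_iff]
  exact ⟨fun h i ha hb => h ⟨ha, hb⟩, fun h i hi => h i hi.1 hi.2⟩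

theorem mono {a b a' b' : ℤ} (ha : a' ≤ a) (hb : b ≤ b') :
    conjSpan x y a b ≤ conjSpan x y a' b' :=
  le_iff.2 fun _ h₁ h₂ => conj_mem (ha.trans h₁) (h₂.trans hb)

theorem shift {a b a' b' : ℤ} (j : ℤ) (ha : a' = a + j) (hb : b' = b + j) {g : G}
    (hg : g ∈ conjSpan x y a b) : x ^ j * g * x ^ (-j) ∈ conjSpan x y a' b' := by
  subst ha hb
  have key : conjSpan x y a b ≤
      (conjSpan x y (a + j) (b + j)).comap (MulAut.conj (x ^ j)).toMonoidHom := by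
    refine le_iff.2 fun i h₁ h₂ => ?_
    have := conj_mem (x := x) (y := y) (i := i + j) (add_le_add_left h₁ j) (add_le_add_left h₂ j)
    rw [Subgroup.mem_comap]
    convert this using 1
    simp only [MulEquiv.coe_toMonoidHom, MulAut.conj_apply]
    group
  rw [zpow_neg]
  exact key hg

theorem shift_gen {a b a' b' i : ℤ} (j k : ℤ) (hk : k = i + j) (ha : a' = a + j)
    (hb : b' = b + j) (h : x ^ i * y * x ^ (-i) ∈ conjSpan x y a b) :
    x ^ k * y * x ^ (-k) ∈ conjSpan x y a' b' := by
  have := shift j ha hb h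
  convert this using 1
  subst hk
  group

/-- If `y` lies both in the span of finitely many conjugates of positive index and in the span of
finitely many conjugates of negative index, then all the conjugates generate a finitely generated
subgroup. -/
theorem fg_of_mem {m n : ℕ} (hpos : x ^ (0 : ℤ) * y * x ^ (-(0 : ℤ)) ∈ conjSpan x y 1 n)
    (hneg : x ^ (0 : ℤ) * y * x ^ (-(0 : ℤ)) ∈ conjSpan x y (-m) (-1)) :
    Group.FG (Subgroup.closure {g : G | ∃ n : ℤ, g = x ^ n * y * x ^ (-n)}) := by
  have up : ∀ k : ℕ, x ^ (k : ℤ) * y * x ^ (-(k : ℤ)) ∈ conjSpan x y 0 (m + n) := by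
    intro k
    induction k using Nat.strong_induction_on with
    | _ k ih =>
      by_cases hk : k ≤ m + n
      · exact conj_mem (by omega) (by omega)
      · have h := shift_gen (k : ℤ) k (by ring) rfl rfl hneg
        refine le_iff.2 (fun i h₁ h₂ => ?_) h
        lift i to ℕ using by omega
        exact ih i (by omega)
  have down : ∀ k : ℕ, x ^ (-(k : ℤ)) * y * x ^ (-(-(k : ℤ))) ∈ conjSpan x y 0 (m + n) := by
    intro k
    induction k using Nat.strong_induction_on with
    | _ k ih =>
      have h := shift_gen (-(k : ℤ)) (-(k : ℤ)) (by ring) rfl rfl hpos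
      refine le_iff.2 (fun i h₁ h₂ => ?_) h
      obtain ⟨l, rfl | rfl⟩ := i.eq_nat_or_neg
      · exact up l
      · exact ih l (by omega)
  have heq : Subgroup.closure {g : G | ∃ n : ℤ, g = x ^ n * y * x ^ (-n)} =
      conjSpan x y 0 (m + n) := by
    apply le_antisymm
    · rw [Subgroup.closure_le]
      rintro _ ⟨i, rfl⟩
      obtain ⟨l, rfl | rfl⟩ := i.eq_nat_or_neg
      · exact up l
      · exact down l
    · exact le_iff.2 fun i _ _ => Subgroup.subset_closure ⟨i, rfl⟩
  rw [heq, Group.fg_iff_subgroup_fg, Subgroup.fg_iff]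
  exact ⟨_, rfl, (Set.finite_Icc _ _).image _⟩

/-- If a positive power of `x` lies in the span of finitely many conjugates, then all the
conjugates generate a finitely generated subgroup. -/
theorem fg_of_pow_mem {d N : ℕ} (hd : 0 < d) (h : x ^ (d : ℤ) ∈ conjSpan x y 0 N) :
    Group.FG (Subgroup.closure {g : G | ∃ n : ℤ, g = x ^ n * y * x ^ (-n)}) := by
  have hup : x ^ ((N : ℤ) + 1) * y * x ^ (-((N : ℤ) + 1)) ∈ conjSpan x y (-d) N := by
    have h₁ := mono (x := x) (y := y) (a' := -d) (by omega) le_rfl h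
    have h₂ := conj_mem (x := x) (y := y) (a := -d) (b := N) (i := (N : ℤ) + 1 - d)
      (by omega) (by omega)
    convert mul_mem (mul_mem h₁ h₂) (inv_mem h₁) using 1
    group
  have hdown : x ^ (-1 : ℤ) * y * x ^ (-(-1 : ℤ)) ∈ conjSpan x y 0 (N + d) := by
    have h₁ := mono (x := x) (y := y) (b' := N + d) le_rfl (by omega) h
    have h₂ := conj_mem (x := x) (y := y) (a := 0) (b := N + d) (i := (d : ℤ) - 1)
      (by omega) (by omega)
    convert mul_mem (mul_mem (inv_mem h₁) h₂) h₁ using 1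
    group
  exact fg_of_mem (n := N + d + 1) (m := d + N + 1)
    (shift_gen 1 0 (by ring) (by ring) (by push_cast; ring) hdown)
    (shift_gen (-(N + 1)) 0 (by ring) (by push_cast; ring) (by ring) hup)

end conjSpan

section PositiveWords

variable {G : Type*} [Group G] {x y : G}

/-- The value in `G` of a positive word in `x` and `y x y⁻¹`. -/
def wordVal (x y : G) (w : List Bool) : G :=
  (w.map fun b => if b then x else y * x * y⁻¹).prod

theorem wordVal_cons (b : Bool) (w : List Bool) :
    wordVal x y (b :: w) = (if b then x else y * x * y⁻¹) * wordVal x y w := by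
  simp [wordVal]

theorem wordVal_concat (b : Bool) (w : List Bool) :
    wordVal x y (w ++ [b]) = wordVal x y w * (if b then x else y * x * y⁻¹) := by
  simp [wordVal]

theorem wordVal_mul_zpow_mem (w : List Bool) :
    wordVal x y w * x ^ (-(w.length : ℤ)) ∈ conjSpan x y 0 w.length := by
  induction w with
  | nil => simp [wordVal]
  | cons b w ih =>
    have h := conjSpan.mono (a' := 0) (by omega) le_rfl (conjSpan.shift 1 rfl rfl ih)
    have h₀ := conjSpan.conj_mem (x := x) (y := y) (a := 0) (b := w.length + 1) (i := 0)
      le_rfl (by omega)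
    have h₁ := conjSpan.conj_mem (x := x) (y := y) (a := 0) (b := w.length + 1) (i := 1)
      (by omega) (by omega)
    rw [wordVal_cons, List.length_cons]
    push_cast
    cases b
    · convert mul_mem (mul_mem h₀ (inv_mem h₁)) h using 1
      simp
      group
    · convert h using 1
      simp
      group

/-- If words `x u` and `y x y⁻¹ v` with `u`, `v` of equal length have equal values, then `y` is in
the span of finitely many conjugates of positive index. -/
theorem mem_of_wordVal_cons_eq {u v : List Bool} (hl : u.length = v.length)
    (h : wordVal x y (true :: u) = wordVal x y (false :: v)) :
    x ^ (0 : ℤ) * y * x ^ (-(0 : ℤ)) ∈ conjSpan x y 1 (u.length + 1 : ℕ) := by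
  have hu := conjSpan.shift 1 (a' := 1) (b' := (u.length + 1 : ℕ)) (by ring) (by push_cast; ring)
    (wordVal_mul_zpow_mem (x := x) (y := y) u)
  have hv := conjSpan.shift 1 (a' := 1) (b' := (u.length + 1 : ℕ)) (by ring)
    (by rw [hl]; push_cast; ring) (wordVal_mul_zpow_mem (x := x) (y := y) v)
  have h₁ := conjSpan.conj_mem (x := x) (y := y) (a := 1) (b := (u.length + 1 : ℕ)) (i := 1)
    le_rfl (by omega)
  simp only [wordVal_cons, if_true, Bool.false_eq_true, if_false] at h
  rw [← hl] at hv
  have hU : wordVal x y u = x⁻¹ * (y * x * y⁻¹ * wordVal x y v) := by rw [← h]; group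
  rw [hU] at hu
  convert mul_mem (mul_mem hu (inv_mem hv)) h₁ using 1
  group

/-- If words `u x` and `v y x y⁻¹` with `u`, `v` of equal length have equal values, then `y` is in
the span of finitely many conjugates of negative index. -/
theorem mem_of_wordVal_concat_eq {u v : List Bool} (hl : u.length = v.length)
    (h : wordVal x y (u ++ [true]) = wordVal x y (v ++ [false])) :
    x ^ (0 : ℤ) * y * x ^ (-(0 : ℤ)) ∈ conjSpan x y (-(u.length + 1 : ℕ)) (-1) := by
  have hu := wordVal_mul_zpow_mem (x := x) (y := y) u
  have hv := wordVal_mul_zpow_mem (x := x) (y := y) v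
  have hn := conjSpan.conj_mem (x := x) (y := y) (a := 0) (b := u.length) (i := u.length)
    (by omega) le_rfl
  simp only [wordVal_concat, if_true, Bool.false_eq_true, if_false] at h
  rw [← hl] at hv
  have hU : wordVal x y u = wordVal x y v * (y * x * y⁻¹) * x⁻¹ := by rw [← h]; group
  rw [hU] at hu
  refine conjSpan.shift_gen (a := 0) (b := u.length) (i := u.length + 1) (-(u.length + 1)) 0
    (by ring) (by push_cast; ring) (by ring) ?_
  convert mul_mem (mul_mem (inv_mem hu) hv) hn using 1
  group

theorem exists_mem_pos {u v : List Bool} (hl : u.length = v.length) (hne : u ≠ v)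
    (h : wordVal x y u = wordVal x y v) :
    ∃ n : ℕ, x ^ (0 : ℤ) * y * x ^ (-(0 : ℤ)) ∈ conjSpan x y 1 n := by
  induction u generalizing v with
  | nil => exact absurd (List.length_eq_zero_iff.1 hl.symm).symm hne
  | cons a u ih =>
    obtain _ | ⟨b, v⟩ := v
    · simp at hl
    have hl' : u.length = v.length := by simpa using hl
    by_cases hab : a = b
    · subst hab
      rw [wordVal_cons, wordVal_cons] at h
      exact ih hl' (fun e => hne (by rw [e])) (mul_left_cancel h)
    · cases a <;> cases b <;> first | exact absurd rfl hab | skip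
      · exact ⟨_, mem_of_wordVal_cons_eq hl'.symm h.symm⟩
      · exact ⟨_, mem_of_wordVal_cons_eq hl' h⟩

theorem exists_mem_neg {u v : List Bool} (hl : u.length = v.length) (hne : u ≠ v)
    (h : wordVal x y u = wordVal x y v) :
    ∃ m : ℕ, x ^ (0 : ℤ) * y * x ^ (-(0 : ℤ)) ∈ conjSpan x y (-m) (-1) := by
  induction u using List.reverseRecOn generalizing v with
  | nil => exact absurd (List.length_eq_zero_iff.1 hl.symm).symm hne
  | append_singleton u a ih =>
    obtain rfl | ⟨v, b, rfl⟩ := v.eq_nil_or_concat'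
    · simp at hl
    have hl' : u.length = v.length := by simpa using hl
    by_cases hab : a = b
    · subst hab
      rw [wordVal_concat, wordVal_concat] at h
      exact ih hl' (fun e => hne (by rw [e])) (mul_right_cancel h)
    · cases a <;> cases b <;> first | exact absurd rfl hab | skip
      · exact ⟨_, mem_of_wordVal_concat_eq hl'.symm h.symm⟩
      · exact ⟨_, mem_of_wordVal_concat_eq hl' h⟩

theorem fg_of_length_lt {u v : List Bool} (hl : v.length < u.length)
    (h : wordVal x y u = wordVal x y v) :
    Group.FG (Subgroup.closure {g : G | ∃ n : ℤ, g = x ^ n * y * x ^ (-n)}) := by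
  have hu := wordVal_mul_zpow_mem (x := x) (y := y) u
  have hv := conjSpan.mono (b' := u.length) le_rfl (by omega)
    (wordVal_mul_zpow_mem (x := x) (y := y) v)
  refine conjSpan.fg_of_pow_mem (d := u.length - v.length) (N := u.length) (by omega) ?_
  rw [h] at hu
  convert mul_mem (inv_mem hu) hv using 1
  rw [Nat.cast_sub hl.le]
  group

end PositiveWords

/-- If `Γ = ⟨x, y⟩` and the subgroup generated by the conjugates `xⁿ y x⁻ⁿ` is
not finitely generated, then `x` and `y x y⁻¹` are positively independent. -/
theorem stmt_16 (Γ : Type*) [Group Γ] (x y : Γ)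
    (hgen : Subgroup.closure ({x, y} : Set Γ) = ⊤)
    (hM : ¬ Group.FG (Subgroup.closure {g : Γ | ∃ n : ℤ, g = x ^ n * y * x ^ (-n)})) :
    PosIndep x (y * x * y⁻¹) := by
  intro u v huv
  have h : wordVal x y u.toList = wordVal x y v.toList := by
    simpa only [FreeMonoid.lift_apply, wordVal] using huv
  by_contra hne
  have hne' : u.toList ≠ v.toList := fun e => hne (FreeMonoid.toList.injective e)
  apply hM
  rcases lt_trichotomy u.toList.length v.toList.length with hl | hl | hl
  · exact fg_of_length_lt hl h.symm
  · obtain ⟨n, hn⟩ := exists_mem_pos hl hne' h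
    obtain ⟨m, hm⟩ := exists_mem_neg hl hne' h
    exact conjSpan.fg_of_mem hn hm
  · exact fg_of_length_lt hl h
end

section
/- Every finitely generated group G that is not virtually nilpotent has a just non virtually nilpotent quotient: there exists a normal subgroup N of G such that G/N is not virtually nilpotent, while for every normal subgroup N' of G strictly containing N, the quotient G/N' is virtually nilpotent. -/
open Pointwise

open commutatorElement

/-- The terms of the lower central series of a finitely generated group are finitely generated
as normal subgroups. -/
theorem isFinitelyNormallyGenerated_lowerCentralSeries_top (H : Type*) [Group H] [Group.FG H]
    (n : ℕ) : ((⊤ : Subgroup H).lowerCentralSeries n).IsFinitelyNormallyGenerated := by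
  obtain ⟨S, hS, hSfin⟩ := Group.fg_iff.mp ‹Group.FG H›
  induction n with
  | zero =>
    refine ⟨S, hSfin, top_le_iff.mp ?_⟩
    rw [← hS]
    exact Subgroup.closure_le_normalClosure
  | succ n ih =>
    obtain ⟨T, hTfin, hT⟩ := ih
    refine ⟨Set.image2 (fun t s : H => ⁅t, s⁆) T S, hTfin.image2 _ hSfin, le_antisymm ?_ ?_⟩
    · refine Subgroup.normalClosure_le_normal ?_
      rintro _ ⟨t, ht, s, -, rfl⟩
      rw [Subgroup.lowerCentralSeries_succ]
      exact Subgroup.commutator_mem_commutator (hT ▸ Subgroup.subset_normalClosure ht)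
        (Subgroup.mem_top s)
    · set K := Subgroup.normalClosure (Set.image2 (fun t s : H => ⁅t, s⁆) T S)
      have key (a b : H) :
          (a : H ⧸ K) * (b : H ⧸ K) = (b : H ⧸ K) * (a : H ⧸ K) ↔ ⁅a, b⁆ ∈ K := by
        rw [← QuotientGroup.eq_one_iff, ← commutatorElement_eq_one_iff_mul_comm]
        rfl
      have hcenter : (⊤ : Subgroup H).lowerCentralSeries n ≤
          (Subgroup.center (H ⧸ K)).comap (QuotientGroup.mk' K) := by
        rw [← hT]
        refine Subgroup.normalClosure_le_normal fun t ht => ?_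
        have hcomm : (⊤ : Subgroup H) ≤
            (Subgroup.centralizer {(t : H ⧸ K)}).comap (QuotientGroup.mk' K) := by
          rw [← hS, Subgroup.closure_le]
          intro s hs
          simp only [Subgroup.coe_comap, Set.mem_preimage, SetLike.mem_coe,
            Subgroup.mem_centralizer_singleton_iff, QuotientGroup.mk'_apply]
          exact ((key t s).mpr (Subgroup.subset_normalClosure ⟨t, ht, s, hs, rfl⟩)).symm
        refine Subgroup.mem_center_iff.mpr fun g => ?_
        obtain ⟨h, rfl⟩ := QuotientGroup.mk_surjective g
        exact Subgroup.mem_centralizer_singleton_iff.mp (hcomm (Subgroup.mem_top h))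
      rw [Subgroup.lowerCentralSeries_succ, Subgroup.commutator_le]
      intro x hx h _
      exact (key x h).mp (Subgroup.mem_center_iff.mp (hcenter hx) h).symm

/-- The quotient by `N` is virtually nilpotent iff some term of the lower central series of some
finite index subgroup is contained in `N`. -/
theorem virtuallyNilpotent_quotient_iff {G : Type*} [Group G] (N : Subgroup G) [N.Normal] :
    VirtuallyNilpotent (G ⧸ N) ↔
      ∃ (H : Subgroup G) (n : ℕ), H.FiniteIndex ∧ H.lowerCentralSeries n ≤ N := by
  have hsurj := QuotientGroup.mk'_surjective N
  constructor
  · rintro ⟨H, hfin, hnil⟩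
    obtain ⟨n, hn⟩ := (Subgroup.isNilpotent_iff_lowerCentralSeries H).mp hnil
    refine ⟨H.comap (QuotientGroup.mk' N), n, ⟨?_⟩, ?_⟩
    · rw [Subgroup.index_comap_of_surjective H hsurj]
      exact hfin.index_ne_zero
    · refine le_of_le_of_eq ((Subgroup.map_eq_bot_iff _).mp ?_) (QuotientGroup.ker_mk' N)
      rw [Subgroup.map_lowerCentralSeries, Subgroup.map_comap_eq_self_of_surjective hsurj, hn]
  · rintro ⟨H, n, hfin, hn⟩
    refine ⟨H.map (QuotientGroup.mk' N), ⟨?_⟩,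
      Subgroup.isNilpotent_of_lowerCentralSeries_eq_bot (n := n) ?_⟩
    · exact ne_zero_of_dvd_ne_zero hfin.index_ne_zero (H.index_map_dvd hsurj)
    · rwa [← Subgroup.map_lowerCentralSeries, Subgroup.map_eq_bot_iff, QuotientGroup.ker_mk']

/-- If a term of the lower central series of a finitely generated subgroup lies in the union of a
chain of normal subgroups, then it already lies in a member of the chain. -/
theorem exists_lowerCentralSeries_le_of_le_sSup {G : Type*} [Group G] {H : Subgroup G}
    [Group.FG H] {n : ℕ} {c : Set (Subgroup G)} (hc : IsChain (· ≤ ·) c) (hne : c.Nonempty)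
    (hnormal : ∀ K ∈ c, K.Normal) (hle : H.lowerCentralSeries n ≤ sSup c) :
    ∃ K ∈ c, H.lowerCentralSeries n ≤ K := by
  obtain ⟨T, hTfin, hT⟩ := isFinitelyNormallyGenerated_lowerCentralSeries_top H n
  rw [← Subgroup.top_subtype_lowerCentralSeries, ← hT] at hle ⊢
  have hTsub : ((hTfin.image H.subtype).toFinset : Set G) ⊆ ⋃ K ∈ c, (K : Set G) := by
    rw [Set.Finite.coe_toFinset]
    rintro _ ⟨t, ht, rfl⟩
    obtain ⟨K, hK, htK⟩ := (Subgroup.mem_sSup_of_directedOn hne hc.directedOn).mp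
      (hle (Subgroup.mem_map_of_mem _ (Subgroup.subset_normalClosure ht)))
    exact Set.mem_biUnion hK htK
  obtain ⟨K, hK, hTK⟩ := DirectedOn.exists_mem_subset_of_finset_subset_biUnion
    (f := fun K : Subgroup G => (K : Set G)) hne hc.directedOn hTsub
  rw [Set.Finite.coe_toFinset, Set.image_subset_iff] at hTK
  have := hnormal K hK
  exact ⟨K, hK, Subgroup.map_le_iff_le_comap.mpr (Subgroup.normalClosure_le_normal hTK)⟩

/-- Every finitely generated non virtually nilpotent group has a just non
virtually nilpotent quotient. -/
theorem stmt_17 (G : Type*) [Group G] [Group.FG G] (hnvn : ¬ VirtuallyNilpotent G) :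
    ∃ (N : Subgroup G) (hN : N.Normal),
      haveI := hN
      ¬ VirtuallyNilpotent (G ⧸ N) ∧
        ∀ (N' : Subgroup G) [N'.Normal], N < N' → VirtuallyNilpotent (G ⧸ N') := by
  obtain ⟨N, -, hN⟩ := zorn_le_nonempty₀
    {N : Subgroup G | N.Normal ∧
      ¬ ∃ (H : Subgroup G) (n : ℕ), H.FiniteIndex ∧ H.lowerCentralSeries n ≤ N}
    (fun c hcS hc K hK => by
      refine ⟨sSup c, ⟨Subgroup.sSup_normal c fun L hL => (hcS hL).1, ?_⟩,
        fun L hL => le_sSup hL⟩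
      rintro ⟨H, n, hfin, hle⟩
      obtain ⟨L, hL, hHL⟩ := exists_lowerCentralSeries_le_of_le_sSup hc ⟨K, hK⟩
        (fun L hL => (hcS hL).1) hle
      exact (hcS hL).2 ⟨H, n, hfin, hHL⟩)
    ⊥ ⟨inferInstance, fun ⟨H, n, hfin, hle⟩ => hnvn
      ⟨H, hfin, Subgroup.isNilpotent_of_lowerCentralSeries_eq_bot (le_bot_iff.mp hle)⟩⟩
  have hnormal := hN.prop.1
  refine ⟨N, hnormal, fun h => hN.prop.2 ((virtuallyNilpotent_quotient_iff N).mp h),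
    fun N' hN' hlt => ?_⟩
  by_contra h
  exact hN.not_prop_of_gt hlt ⟨hN', fun h' => h ((virtuallyNilpotent_quotient_iff N').mpr h')⟩
end
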